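/- Let Δ = (T, 𝒮, ℬ) be a strong triangle blocking arrangement with vertices x₁, x₂, x₃ of T. Suppose there are vertices a₁, b₁ ∈ x₁x₂ and a₂, b₂ ∈ x₂x₃ such that x₁, b₁, a₁, x₂ appear in this order on the edge x₁x₂, x₃, a₂, b₂, x₂ appear in this order on the edge x₂x₃, and a₁a₂, b₁b₂ are proper initial segments intersecting at a point c. Let R₁ be the triangular 𝒮̄-region with vertices a₁, b₁, c (bounded by the subsegment a₁b₁ of x₁x₂, the subsegment b₁c of b₁b₂ and the subsegment ca₁ of a₁a₂) and R₂ the triangular 𝒮̄-region with vertices a₂, b₂, c (bounded by the subsegment a₂b₂ of x₂x₃, the subsegment b₂c of b₁b₂ and the subsegment ca₂ of a₁a₂). Then the vertices a₁, b₁ and c are externally blocked in R₁, and the vertices a₂, b₂ and c are externally blocked in R₂. -/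

import Mathlib

open Set

noncomputable section

/-- Points of the real plane. -/
abbrev Pt := ℝ × ℝ

/-- The boundary of the triangle with vertices `x1`, `x2`, `x3`:
the union of its three edges. -/
def triBdry (x1 x2 x3 : Pt) : Set Pt :=
  segment ℝ x1 x2 ∪ segment ℝ x2 x3 ∪ segment ℝ x3 x1

/-- The three edges of the triangle with vertices `x1`, `x2`, `x3`. -/
def triEdges (x1 x2 x3 : Pt) : Set (Set Pt) :=
  {segment ℝ x1 x2, segment ℝ x2 x3, segment ℝ x3 x1}

/-- A triangle blocking arrangement: a nondegenerate triangle `x1 x2 x3` together with two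
finite collections `S` (proper initial segments) and `B` (blocking segments) of closed
segments with endpoints on the boundary of the triangle and no interior point on the
boundary, satisfying the intersection conditions (i) and (ii). `S ∪ triEdges x1 x2 x3`
is the collection of initial segments `𝒮̄`. -/
structure TBA where
  x1 : Pt
  x2 : Pt
  x3 : Pt
  S : Set (Set Pt)
  B : Set (Set Pt)
  indep : AffineIndependent ℝ ![x1, x2, x3]
  finS : S.Finite
  finB : B.Finite
  seg_wf : ∀ s ∈ S ∪ B, ∃ a b : Pt, a ≠ b ∧ s = segment ℝ a b ∧
    a ∈ triBdry x1 x2 x3 ∧ b ∈ triBdry x1 x2 x3 ∧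
    ∀ p ∈ openSegment ℝ a b, p ∉ triBdry x1 x2 x3
  /- (i) no three initial segments are concurrent … -/
  no_three_concurrent : ∀ s₁ ∈ S ∪ triEdges x1 x2 x3, ∀ s₂ ∈ S ∪ triEdges x1 x2 x3,
    ∀ s₃ ∈ S ∪ triEdges x1 x2 x3, s₁ ≠ s₂ → s₁ ≠ s₃ → s₂ ≠ s₃ →
    ¬ ∃ p : Pt, p ∈ s₁ ∧ p ∈ s₂ ∧ p ∈ s₃
  /- … and through every intersection point of two initial segments, not both edges,
  there is a unique blocking segment … -/
  block_exists : ∀ s₁ ∈ S ∪ triEdges x1 x2 x3, ∀ s₂ ∈ S ∪ triEdges x1 x2 x3, s₁ ≠ s₂ →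
    ¬ (s₁ ∈ triEdges x1 x2 x3 ∧ s₂ ∈ triEdges x1 x2 x3) →
    ∀ p : Pt, p ∈ s₁ → p ∈ s₂ → ∃! b, b ∈ B ∧ p ∈ b
  /- … while through an intersection point of two edges there is at most one
  blocking segment. -/
  block_unique : ∀ s₁ ∈ S ∪ triEdges x1 x2 x3, ∀ s₂ ∈ S ∪ triEdges x1 x2 x3, s₁ ≠ s₂ →
    ∀ p : Pt, p ∈ s₁ → p ∈ s₂ → ∀ b₁ ∈ B, ∀ b₂ ∈ B, p ∈ b₁ → p ∈ b₂ → b₁ = b₂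
  /- (ii) through every intersection point of an initial segment and a blocking segment
  there is a unique second initial segment. -/
  second_segment : ∀ s ∈ S ∪ triEdges x1 x2 x3, ∀ b ∈ B, ∀ p : Pt, p ∈ s → p ∈ b →
    ∃! s', s' ∈ S ∪ triEdges x1 x2 x3 ∧ s' ≠ s ∧ p ∈ s'

namespace TBA

variable (Δ : TBA)

/-- The collection `𝒮̄` of initial segments. -/
def Sbar : Set (Set Pt) := Δ.S ∪ triEdges Δ.x1 Δ.x2 Δ.x3

/-- The (closed) triangle `T`. -/
def tri : Set Pt := convexHull ℝ {Δ.x1, Δ.x2, Δ.x3}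

/-- The boundary `∂T`. -/
def bdry : Set Pt := triBdry Δ.x1 Δ.x2 Δ.x3

/-- A vertex of the arrangement: an intersection point of two initial segments. -/
def IsVertex (p : Pt) : Prop :=
  ∃ s₁ ∈ Δ.Sbar, ∃ s₂ ∈ Δ.Sbar, s₁ ≠ s₂ ∧ p ∈ s₁ ∧ p ∈ s₂

/-- The segment `xy` is minimal if no vertex of the arrangement lies in its interior. -/
def MinimalSeg (x y : Pt) : Prop :=
  ∀ p ∈ openSegment ℝ x y, ¬ Δ.IsVertex p

/-- An `𝒮̄`-region: the closure of a connected component of `T \ ⋃ L` for some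
subset `L` of `𝒮̄`. -/
def IsRegion (R : Set Pt) : Prop :=
  ∃ L ⊆ Δ.Sbar, ∃ p ∈ Δ.tri \ ⋃₀ L,
    R = closure (connectedComponentIn (Δ.tri \ ⋃₀ L) p)

/-- A minimal `𝒮̄`-region: the closure of a connected component of `T \ ⋃ 𝒮̄`. -/
def IsMinRegion (R : Set Pt) : Prop :=
  ∃ p ∈ Δ.tri \ ⋃₀ Δ.Sbar,
    R = closure (connectedComponentIn (Δ.tri \ ⋃₀ Δ.Sbar) p)

/-- The set `s` contains an edge of the region `R`: it contains a nondegenerate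
segment lying on the boundary of `R`. -/
def ContainsEdgeOf (_Δ : TBA) (s R : Set Pt) : Prop :=
  ∃ q₁ q₂ : Pt, q₁ ≠ q₂ ∧ segment ℝ q₁ q₂ ⊆ s ∩ frontier R

/-- A vertex of the region `R`: a point of `R` that is the intersection of two initial
segments, each containing an edge of `R`. -/
def IsRegionVertex (R : Set Pt) (p : Pt) : Prop :=
  p ∈ R ∧ ∃ s₁ ∈ Δ.Sbar, ∃ s₂ ∈ Δ.Sbar, s₁ ≠ s₂ ∧ p ∈ s₁ ∧ p ∈ s₂ ∧
    Δ.ContainsEdgeOf s₁ R ∧ Δ.ContainsEdgeOf s₂ R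

/-- A vertex `p` is internally blocked in the region `R` if the blocking segment
through `p` exists and meets the interior of `R`.  (Externally blocked means not
internally blocked.) -/
def InternallyBlocked (R : Set Pt) (p : Pt) : Prop :=
  ∃ b ∈ Δ.B, p ∈ b ∧ (b ∩ interior R).Nonempty

/-- Two consecutive vertices of a region `R`: distinct vertices joined by an edge
lying on the boundary of `R`. -/
def Consec (R : Set Pt) (u v : Pt) : Prop :=
  u ≠ v ∧ Δ.IsRegionVertex R u ∧ Δ.IsRegionVertex R v ∧ segment ℝ u v ⊆ frontier R

/-- Condition (A): the arrangement is strong when for every minimal `𝒮̄`-region `R` and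
consecutive vertices `v₁, v₂, v₃, v₄, v₅` in this order along `∂R`, if the line
`l(v₁v₂)` and the blocking segment `β(v₃)` intersect inside `T`, and `β(v₃)` meets the
interior of `R`, then `l(v₁v₂)`, `β(v₃)` and `l(v₄v₅)` are concurrent. -/
def Strong : Prop :=
  ∀ R : Set Pt, Δ.IsMinRegion R →
  ∀ v₁ v₂ v₃ v₄ v₅ : Pt, List.Pairwise (· ≠ ·) [v₁, v₂, v₃, v₄, v₅] →
    Δ.Consec R v₁ v₂ → Δ.Consec R v₂ v₃ → Δ.Consec R v₃ v₄ → Δ.Consec R v₄ v₅ →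
    ∀ b ∈ Δ.B, v₃ ∈ b → (b ∩ interior R).Nonempty →
    (∃ q ∈ Δ.tri, q ∈ affineSpan ℝ ({v₁, v₂} : Set Pt) ∧ q ∈ b) →
    ∃ q : Pt, q ∈ b ∧ q ∈ affineSpan ℝ ({v₁, v₂} : Set Pt) ∧
      q ∈ affineSpan ℝ ({v₄, v₅} : Set Pt)

end TBA

/-- The affine function on the plane with coefficients `k`. -/
def aff (k : ℝ × ℝ × ℝ) (z : Pt) : ℝ := k.1 * z.1 + k.2.1 * z.2 + k.2.2

theorem aff_lineMap (k : ℝ × ℝ × ℝ) (u z : Pt) (t : ℝ) :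
    aff k (u + t • (z - u)) = (1 - t) * aff k u + t * aff k z := by
  simp [aff]; ring

theorem continuous_aff (k : ℝ × ℝ × ℝ) : Continuous (aff k) := by
  unfold aff; fun_prop

/-- The planar cross product. -/
def crs (u v : Pt) : ℝ := u.1 * v.2 - u.2 * v.1

theorem exists_of_crs_eq_zero {u v : Pt} (hu : u ≠ 0) (h : crs u v = 0) : ∃ t : ℝ, v = t • u := by
  obtain ⟨a, b⟩ := u
  obtain ⟨c, d⟩ := v
  simp only [crs] at h
  by_cases ha : a = 0
  · have hb : b ≠ 0 := by rintro rfl; exact hu (by simp [ha])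
    refine ⟨d / b, ?_⟩
    subst ha
    have : c = 0 := by
      have : b * c = 0 := by linarith
      simpa [hb] using this
    ext <;> simp [this, hb]
  · refine ⟨c / a, ?_⟩
    ext
    · simp [ha]
    · simp; field_simp; linarith

/-- An affine function vanishing at three noncollinear points vanishes identically. -/
theorem aff_eq_zero_of_noncollinear {k : ℝ × ℝ × ℝ} {u v w : Pt} (hu : aff k u = 0)
    (hv : aff k v = 0) (hw : aff k w = 0) (h : crs (v - u) (w - u) ≠ 0) (z : Pt) :
    aff k z = 0 := by
  have key : crs (v - u) (w - u) * aff k z =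
      crs (z - u) (w - u) * (aff k v - aff k u) + crs (v - u) (z - u) * (aff k w - aff k u)
        + crs (v - u) (w - u) * aff k u := by
    simp [aff, crs]; ring
  rw [hu, hv, hw] at key
  have : crs (v - u) (w - u) * aff k z = 0 := by rw [key]; ring
  exact (mul_eq_zero.mp this).resolve_left h

theorem aff_eq_zero_iff_of_ne {k l : ℝ × ℝ × ℝ} (hk : ∃ z, aff k z ≠ 0) (hl : ∃ z, aff l z ≠ 0)
    {u v : Pt} (huv : u ≠ v) (hku : aff k u = 0) (hkv : aff k v = 0) (hlu : aff l u = 0)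
    (hlv : aff l v = 0) (z : Pt) : aff k z = 0 ↔ aff l z = 0 := by
  have main : ∀ {k l : ℝ × ℝ × ℝ}, (∃ z, aff k z ≠ 0) → aff k u = 0 → aff k v = 0 →
      aff l u = 0 → aff l v = 0 → aff k z = 0 → aff l z = 0 := by
    intro k l ⟨x, hx⟩ hku hkv hlu hlv hz
    have h0 : crs (v - u) (z - u) = 0 := by
      by_contra h
      exact hx (aff_eq_zero_of_noncollinear hku hkv hz h x)
    obtain ⟨t, ht⟩ := exists_of_crs_eq_zero (sub_ne_zero.mpr huv.symm) h0
    have : z = u + t • (v - u) := by rw [← ht]; abel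
    rw [this, aff_lineMap, hlu, hlv]; ring
  exact ⟨main hk hku hkv hlu hlv, main hl hlu hlv hku hkv⟩

/-- A common zero on a segment where an affine function changes sign. -/
theorem exists_aff_eq_zero {k : ℝ × ℝ × ℝ} {u v : Pt} (h : aff k u * aff k v < 0) :
    ∃ t : ℝ, 0 < t ∧ t < 1 ∧ aff k (u + t • (v - u)) = 0 := by
  have hne : aff k u - aff k v ≠ 0 := by
    intro h0
    have : aff k u = aff k v := by linarith
    rw [this] at h; nlinarith [mul_self_nonneg (aff k v)]
  refine ⟨aff k u / (aff k u - aff k v), ?_, ?_, ?_⟩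
  · rcases mul_neg_iff.mp h with ⟨h1, h2⟩ | ⟨h1, h2⟩
    · exact div_pos h1 (by linarith)
    · exact div_pos_of_neg_of_neg h1 (by linarith)
  · rcases mul_neg_iff.mp h with ⟨h1, h2⟩ | ⟨h1, h2⟩
    · rw [div_lt_one (by linarith)]; linarith
    · rw [div_lt_one_of_neg (by linarith)]; linarith
  · rw [aff_lineMap]; field_simp; ring

theorem aff_mul_neg_of_zero_between {k : ℝ × ℝ × ℝ} {u v : Pt} {t : ℝ} (h0 : 0 < t) (h1 : t < 1)
    (h : aff k (u + t • (v - u)) = 0) (hu : aff k u ≠ 0) : aff k u * aff k v < 0 := by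
  rw [aff_lineMap] at h
  have hv : t * (aff k u * aff k v) = -((1 - t) * (aff k u * aff k u)) := by
    linear_combination aff k u * h
  have : 0 < (1 - t) * (aff k u * aff k u) :=
    mul_pos (by linarith) (mul_self_pos.mpr hu)
  by_contra hc
  push Not at hc
  nlinarith [mul_nonneg h0.le hc]

namespace TBA

variable (Δ : TBA)

theorem exists_barycentric : ∃ g : Fin 3 → ℝ × ℝ × ℝ,
    (∀ z, z ∈ Δ.tri ↔ ∀ i, 0 ≤ aff (g i) z) ∧
    (∀ z, aff (g 0) z + aff (g 1) z + aff (g 2) z = 1) ∧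
    (∀ z w, (∀ i, aff (g i) z = aff (g i) w) → z = w) ∧
    (∀ i, {z | z ∈ Δ.tri ∧ aff (g i) z = 0} ∈ triEdges Δ.x1 Δ.x2 Δ.x3) ∧
    (∀ e ∈ triEdges Δ.x1 Δ.x2 Δ.x3, ∃ i, e = {z | z ∈ Δ.tri ∧ aff (g i) z = 0}) := by
  obtain ⟨x1, x2, x3, hx1, hx2, hx3⟩ : ∃ x1 x2 x3, Δ.x1 = x1 ∧ Δ.x2 = x2 ∧ Δ.x3 = x3 :=
    ⟨_, _, _, rfl, rfl, rfl⟩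
  have hD : crs (x2 - x1) (x3 - x1) ≠ 0 := by
    intro h
    have hne : x2 - x1 ≠ 0 := by
      rw [sub_ne_zero, ← hx1, ← hx2]
      intro h
      exact absurd (Δ.indep.injective (a₁ := 1) (a₂ := 0) (by simpa using h)) (by decide)
    obtain ⟨t, ht⟩ := exists_of_crs_eq_zero hne h
    have hi := Δ.indep
    rw [affineIndependent_iff_not_collinear_set, hx1, hx2, hx3] at hi
    apply hi
    rw [collinear_iff_of_mem (p₀ := x1) (by simp)]
    refine ⟨x2 - x1, ?_⟩
    intro p hp
    simp only [mem_insert_iff, mem_singleton_iff] at hp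
    rcases hp with rfl | rfl | rfl
    · exact ⟨0, by simp⟩
    · exact ⟨1, by simp⟩
    · exact ⟨t, by rw [← ht]; simp⟩
  simp only [tri, hx1, hx2, hx3]
  set D := crs (x2 - x1) (x3 - x1) with hDdef
  let g : Fin 3 → ℝ × ℝ × ℝ := ![
    ((x2.2 - x3.2) / D, (x3.1 - x2.1) / D, (x2.1 * x3.2 - x2.2 * x3.1) / D),
    ((x3.2 - x1.2) / D, (x1.1 - x3.1) / D, (x3.1 * x1.2 - x3.2 * x1.1) / D),
    ((x1.2 - x2.2) / D, (x2.1 - x1.1) / D, (x1.1 * x2.2 - x1.2 * x2.1) / D)]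
  have g0 : ∀ z, aff (g 0) z = ((x2.2 - x3.2) * z.1 + (x3.1 - x2.1) * z.2 +
      (x2.1 * x3.2 - x2.2 * x3.1)) / D := by intro z; simp [g, aff]; ring
  have g1 : ∀ z, aff (g 1) z = ((x3.2 - x1.2) * z.1 + (x1.1 - x3.1) * z.2 +
      (x3.1 * x1.2 - x3.2 * x1.1)) / D := by intro z; simp [g, aff]; ring
  have g2 : ∀ z, aff (g 2) z = ((x1.2 - x2.2) * z.1 + (x2.1 - x1.1) * z.2 +
      (x1.1 * x2.2 - x1.2 * x2.1)) / D := by intro z; simp [g, aff]; ring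
  have hsum : ∀ z, aff (g 0) z + aff (g 1) z + aff (g 2) z = 1 := by
    intro z
    rw [g0, g1, g2, ← add_div, ← add_div, div_eq_one_iff_eq hD, hDdef]
    simp only [crs, Prod.fst_sub, Prod.snd_sub]; ring
  have hrec : ∀ z, z = aff (g 0) z • x1 + aff (g 1) z • x2 + aff (g 2) z • x3 := by
    intro z
    ext
    · rw [g0, g1, g2]; simp only [Prod.fst_add, Prod.smul_fst, smul_eq_mul]
      field_simp
      rw [hDdef]; simp only [crs, Prod.fst_sub, Prod.snd_sub]; ring
    · rw [g0, g1, g2]; simp only [Prod.snd_add, Prod.smul_snd, smul_eq_mul]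
      field_simp
      rw [hDdef]; simp only [crs, Prod.fst_sub, Prod.snd_sub]; ring
  have e01 : aff (g 0) x1 = 1 := by
    rw [g0, div_eq_one_iff_eq hD, hDdef]; simp only [crs, Prod.fst_sub, Prod.snd_sub]; ring
  have e02 : aff (g 0) x2 = 0 := by rw [g0]; simp; left; ring
  have e03 : aff (g 0) x3 = 0 := by rw [g0]; simp; left; ring
  have e11 : aff (g 1) x1 = 0 := by rw [g1]; simp; left; ring
  have e12 : aff (g 1) x2 = 1 := by
    rw [g1, div_eq_one_iff_eq hD, hDdef]; simp only [crs, Prod.fst_sub, Prod.snd_sub]; ring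
  have e13 : aff (g 1) x3 = 0 := by rw [g1]; simp; left; ring
  have e21 : aff (g 2) x1 = 0 := by rw [g2]; simp; left; ring
  have e22 : aff (g 2) x2 = 0 := by rw [g2]; simp; left; ring
  have e23 : aff (g 2) x3 = 1 := by
    rw [g2, div_eq_one_iff_eq hD, hDdef]; simp only [crs, Prod.fst_sub, Prod.snd_sub]; ring
  have hcomb : ∀ i (u v : Pt) (a b : ℝ), a + b = 1 →
      aff (g i) (a • u + b • v) = a * aff (g i) u + b * aff (g i) v := by
    intro i u v a b hab
    have : a = 1 - b := by linarith
    subst this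
    rw [← aff_lineMap]; congr 1; module
  have hfin : ∀ x, 0 ≤ aff (g 0) x → 0 ≤ aff (g 1) x → 0 ≤ aff (g 2) x →
      ∀ i, 0 ≤ aff (g i) x := by
    intro x h0 h1 h2 i
    fin_cases i <;> assumption
  have htri : ∀ z, z ∈ convexHull ℝ {x1, x2, x3} ↔ ∀ i, 0 ≤ aff (g i) z := by
    intro z
    constructor
    · intro hz
      have hsub : convexHull ℝ {x1, x2, x3} ⊆ {z | ∀ i, 0 ≤ aff (g i) z} := by
        apply convexHull_min
        · intro p hp
          simp only [mem_insert_iff, mem_singleton_iff] at hp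
          rcases hp with rfl | rfl | rfl
          · exact hfin _ (by rw [e01]; norm_num) e11.ge e21.ge
          · exact hfin _ e02.ge (by rw [e12]; norm_num) e22.ge
          · exact hfin _ e03.ge e13.ge (by rw [e23]; norm_num)
        · intro u hu v hv a b ha hb hab i
          rw [hcomb i u v a b hab]
          exact add_nonneg (mul_nonneg ha (hu i)) (mul_nonneg hb (hv i))
      exact hsub hz
    · intro h
      rw [hrec z]
      have hc := convex_convexHull ℝ ({x1, x2, x3} : Set Pt)
      have := hc.sum_mem (t := Finset.univ) (w := fun i => aff (g i) z) (z := ![x1, x2, x3])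
        (fun i _ => h i) (by rw [Fin.sum_univ_three]; exact hsum z)
        (by intro i _; apply subset_convexHull; fin_cases i <;> simp)
      rw [Fin.sum_univ_three] at this
      simpa using this
  have hseg : ∀ (i j l : Fin 3) (u v : Pt), aff (g i) u = 1 → aff (g i) v = 0 →
      aff (g j) u = 0 → aff (g j) v = 1 → aff (g l) u = 0 → aff (g l) v = 0 →
      (∀ z, aff (g l) z = 0 → aff (g i) z + aff (g j) z = 1 ∧
        z = aff (g i) z • u + aff (g j) z • v) →
      (∀ m, m = i ∨ m = j ∨ m = l) →
      segment ℝ u v = {z | z ∈ convexHull ℝ {x1, x2, x3} ∧ aff (g l) z = 0} := by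
    intro i j l u v hiu hiv hju hjv hlu hlv hz hm
    ext z
    simp only [mem_ofPred_eq, htri]
    constructor
    · rintro ⟨a, b, ha, hb, hab, rfl⟩
      refine ⟨?_, ?_⟩
      · intro m
        rw [hcomb _ _ _ _ _ hab]
        rcases hm m with rfl | rfl | rfl
        · rw [hiu, hiv]; linarith
        · rw [hju, hjv]; linarith
        · rw [hlu, hlv]; linarith
      · rw [hcomb _ _ _ _ _ hab, hlu, hlv]; ring
    · rintro ⟨h1, h2⟩
      obtain ⟨h3, h4⟩ := hz z h2
      exact ⟨_, _, h1 i, h1 j, h3, h4.symm⟩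
  have s12 := hseg 0 1 2 x1 x2 e01 e02 e11 e12 e21 e22
    (by intro z hz
        refine ⟨by have := hsum z; linarith, ?_⟩
        have := hrec z; rw [hz] at this; simpa using this) (by decide)
  have s23 := hseg 1 2 0 x2 x3 e12 e13 e22 e23 e02 e03
    (by intro z hz
        refine ⟨by have := hsum z; linarith, ?_⟩
        have := hrec z; rw [hz] at this; simpa using this) (by decide)
  have s31 := hseg 2 0 1 x3 x1 e23 e21 e03 e01 e13 e11
    (by intro z hz
        refine ⟨by have := hsum z; linarith, ?_⟩
        have := hrec z; rw [hz] at this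
        rw [add_comm]; simpa using this) (by decide)
  refine ⟨g, htri, hsum, ?_, ?_, ?_⟩
  · intro z w h
    rw [hrec z, hrec w, h 0, h 1, h 2]
  · intro i
    simp only [triEdges, mem_insert_iff, mem_singleton_iff]
    fin_cases i
    · right; left; exact s23.symm
    · right; right; exact s31.symm
    · left; exact s12.symm
  · intro e he
    simp only [triEdges, mem_insert_iff, mem_singleton_iff] at he
    rcases he with rfl | rfl | rfl
    · exact ⟨2, s12⟩
    · exact ⟨0, s23⟩
    · exact ⟨1, s31⟩

/-- Barycentric coordinates of the triangle, as coefficients of affine functions. -/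
def bary : Fin 3 → ℝ × ℝ × ℝ := Δ.exists_barycentric.choose

theorem mem_tri_iff (z : Pt) : z ∈ Δ.tri ↔ ∀ i, 0 ≤ aff (Δ.bary i) z :=
  Δ.exists_barycentric.choose_spec.1 z

theorem sum_bary (z : Pt) :
    aff (Δ.bary 0) z + aff (Δ.bary 1) z + aff (Δ.bary 2) z = 1 :=
  Δ.exists_barycentric.choose_spec.2.1 z

theorem eq_of_bary {z w : Pt} (h : ∀ i, aff (Δ.bary i) z = aff (Δ.bary i) w) : z = w :=
  Δ.exists_barycentric.choose_spec.2.2.1 z w h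

/-- The `i`-th edge of the triangle. -/
def edge (i : Fin 3) : Set Pt := {z | z ∈ Δ.tri ∧ aff (Δ.bary i) z = 0}

theorem edge_mem (i : Fin 3) : Δ.edge i ∈ triEdges Δ.x1 Δ.x2 Δ.x3 :=
  Δ.exists_barycentric.choose_spec.2.2.2.1 i

theorem edge_mem_Sbar (i : Fin 3) : Δ.edge i ∈ Δ.Sbar := Or.inr (Δ.edge_mem i)

theorem exists_eq_edge {e : Set Pt} (he : e ∈ triEdges Δ.x1 Δ.x2 Δ.x3) : ∃ i, e = Δ.edge i :=
  Δ.exists_barycentric.choose_spec.2.2.2.2 e he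

theorem mem_triBdry_iff (z : Pt) : z ∈ triBdry Δ.x1 Δ.x2 Δ.x3 ↔ ∃ i, z ∈ Δ.edge i := by
  constructor
  · intro h
    have : ∃ e ∈ triEdges Δ.x1 Δ.x2 Δ.x3, z ∈ e := by
      rcases h with (h | h) | h
      · exact ⟨_, by simp [triEdges], h⟩
      · exact ⟨_, by simp [triEdges], h⟩
      · exact ⟨_, by simp [triEdges], h⟩
    obtain ⟨e, he, hz⟩ := this
    obtain ⟨i, rfl⟩ := Δ.exists_eq_edge he
    exact ⟨i, hz⟩
  · rintro ⟨i, hi⟩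
    have := Δ.edge_mem i
    simp only [triEdges, mem_insert_iff, mem_singleton_iff] at this
    rcases this with h | h | h <;> rw [h] at hi <;> simp [triBdry, hi]

theorem convex_tri : Convex ℝ Δ.tri := convex_convexHull _ _

theorem isClosed_tri : IsClosed Δ.tri := by
  have : Δ.tri = ⋂ i, {z | 0 ≤ aff (Δ.bary i) z} := by
    ext z; simp [Δ.mem_tri_iff]
  rw [this]
  exact isClosed_iInter fun i => isClosed_le continuous_const (continuous_aff _)

variable {Δ}

theorem add_smul_mem_tri {u v : Pt} (hu : u ∈ Δ.tri) (hv : v ∈ Δ.tri) {t : ℝ} (h0 : 0 ≤ t)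
    (h1 : t ≤ 1) : u + t • (v - u) ∈ Δ.tri :=
  Δ.convex_tri.add_smul_sub_mem hu hv ⟨h0, h1⟩

theorem not_mem_edges_of_mem_S {s : Set Pt} (hs : s ∈ Δ.S ∪ Δ.B) :
    s ∉ triEdges Δ.x1 Δ.x2 Δ.x3 := by
  intro he
  obtain ⟨a, b, hab, rfl, ha, hb, ho⟩ := Δ.seg_wf s hs
  have hm : midpoint ℝ a b ∈ openSegment ℝ a b :=
    ⟨1/2, 1/2, by norm_num, by norm_num, by norm_num, by
      rw [midpoint_eq_smul_add]; simp⟩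
  obtain ⟨i, hi⟩ := Δ.exists_eq_edge he
  apply ho _ hm
  rw [Δ.mem_triBdry_iff]
  exact ⟨i, hi ▸ openSegment_subset_segment _ _ _ hm⟩

theorem exists_line {τ : Set Pt} (hτ : τ ∈ Δ.Sbar ∪ Δ.B) : ∃ k : ℝ × ℝ × ℝ,
    (∃ z, aff k z ≠ 0) ∧ (∀ z, z ∈ τ ↔ z ∈ Δ.tri ∧ aff k z = 0) := by
  have hcase : τ ∈ triEdges Δ.x1 Δ.x2 Δ.x3 ∨ τ ∈ Δ.S ∪ Δ.B := by
    rcases hτ with (h | h) | h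
    · exact Or.inr (Or.inl h)
    · exact Or.inl h
    · exact Or.inr (Or.inr h)
  rcases hcase with h | h
  · obtain ⟨i, rfl⟩ := Δ.exists_eq_edge h
    refine ⟨Δ.bary i, ?_, fun z => Iff.rfl⟩
    by_contra hc
    push Not at hc
    have h0 : ∀ j, Δ.edge j = Δ.edge i := by
      intro j
      by_contra hne
      have hx : ∃ x, x ∈ Δ.edge j := by
        obtain ⟨e, he⟩ : ∃ x, x ∈ Δ.edge j := by
          have := Δ.edge_mem j
          simp only [triEdges, mem_insert_iff, mem_singleton_iff] at this
          rcases this with h | h | h <;> rw [h]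
          exacts [⟨_, left_mem_segment _ _ _⟩, ⟨_, left_mem_segment _ _ _⟩,
            ⟨_, left_mem_segment _ _ _⟩]
        exact ⟨e, he⟩
      have hT : ∀ x, x ∈ Δ.tri → x ∈ Δ.edge i := fun x hx => ⟨hx, hc x⟩
      have hi := Δ.edge_mem i
      have a1 : Δ.x1 ∈ Δ.tri := subset_convexHull _ _ (by simp)
      have a2 : Δ.x2 ∈ Δ.tri := subset_convexHull _ _ (by simp)
      have a3 : Δ.x3 ∈ Δ.tri := subset_convexHull _ _ (by simp)
      have hind := Δ.indep
      rw [affineIndependent_iff_not_collinear_set] at hind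
      apply hind
      simp only [triEdges, mem_insert_iff, mem_singleton_iff] at hi
      rcases hi with h | h | h <;> rw [h] at hT
      · have : Δ.x3 ∈ line[ℝ, Δ.x1, Δ.x2] := (mem_segment_iff_wbtw.mp (hT _ a3)).mem_affineSpan
        have := collinear_insert_of_mem_affineSpan_pair this
        convert this using 1; ext; simp; tauto
      · have : Δ.x1 ∈ line[ℝ, Δ.x2, Δ.x3] := (mem_segment_iff_wbtw.mp (hT _ a1)).mem_affineSpan
        exact collinear_insert_of_mem_affineSpan_pair this
      · have : Δ.x2 ∈ line[ℝ, Δ.x3, Δ.x1] := (mem_segment_iff_wbtw.mp (hT _ a2)).mem_affineSpan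
        have := collinear_insert_of_mem_affineSpan_pair this
        convert this using 1; ext; simp; tauto
    have a1 : Δ.x1 ∈ Δ.tri := subset_convexHull _ _ (by simp)
    have hz : ∀ j, Δ.x1 ∈ Δ.edge j := fun j => (h0 j).symm ▸ ⟨a1, hc _⟩
    have := Δ.sum_bary Δ.x1
    rw [(hz 0).2, (hz 1).2, (hz 2).2] at this
    norm_num at this
  · obtain ⟨a, b, hab, rfl, ha, hb, ho⟩ := Δ.seg_wf τ h
    rw [Δ.mem_triBdry_iff] at ha hb
    obtain ⟨i, hai⟩ := ha
    obtain ⟨j, hbj⟩ := hb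
    have hk : ∀ z, aff (-(b.2 - a.2), b.1 - a.1, a.1 * b.2 - a.2 * b.1) z
        = crs (b - a) (z - a) := by intro z; simp [aff, crs]; ring
    refine ⟨(-(b.2 - a.2), b.1 - a.1, a.1 * b.2 - a.2 * b.1), ?_, ?_⟩
    · refine ⟨a + (-(b.2 - a.2), b.1 - a.1), ?_⟩
      rw [hk]
      simp only [crs, add_sub_cancel_left, Prod.fst_sub, Prod.snd_sub]
      intro h0
      apply hab
      have h1 : b.1 - a.1 = 0 := by nlinarith [sq_nonneg (b.1 - a.1), sq_nonneg (b.2 - a.2)]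
      have h2 : b.2 - a.2 = 0 := by nlinarith [sq_nonneg (b.1 - a.1), sq_nonneg (b.2 - a.2)]
      ext <;> linarith
    · intro z
      rw [hk]
      constructor
      · intro hz
        refine ⟨Δ.convex_tri.segment_subset hai.1 hbj.1 hz, ?_⟩
        rw [segment_eq_image'] at hz
        obtain ⟨t, -, rfl⟩ := hz
        simp [crs]; ring
      · rintro ⟨hzT, hz⟩
        obtain ⟨t, ht⟩ := exists_of_crs_eq_zero (sub_ne_zero.mpr hab.symm) hz
        have hz' : z = a + t • (b - a) := by rw [← ht]; abel
        rw [segment_eq_image']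
        have hT : ∀ l (x : Pt), x ∈ Δ.tri → 0 ≤ aff (Δ.bary l) x :=
          fun l x hx => (Δ.mem_tri_iff x).mp hx l
        have hmid : ∀ l, aff (Δ.bary l) a = 0 → aff (Δ.bary l) b = 0 → False := by
          intro l h1 h2
          apply ho (a + (1/2 : ℝ) • (b - a))
          · rw [openSegment_eq_image']
            exact ⟨1/2, ⟨by norm_num, by norm_num⟩, rfl⟩
          · rw [Δ.mem_triBdry_iff]
            refine ⟨l, add_smul_mem_tri hai.1 hbj.1 (by norm_num) (by norm_num), ?_⟩
            rw [aff_lineMap, h1, h2]; ring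
        refine ⟨t, ⟨?_, ?_⟩, hz'.symm⟩
        · by_contra hneg
          push Not at hneg
          have h1 := hT i z hzT
          rw [hz', aff_lineMap, hai.2] at h1
          have h2 := hT i b hbj.1
          exact hmid i hai.2 (by nlinarith)
        · by_contra hgt
          push Not at hgt
          have h1 := hT j z hzT
          rw [hz', aff_lineMap, hbj.2] at h1
          have h2 := hT j a hai.1
          exact hmid j (by nlinarith) hbj.2

open Classical in
/-- Coefficients of an affine function cutting out `τ` in the triangle. -/
def lineOf (Δ : TBA) (τ : Set Pt) : ℝ × ℝ × ℝ :=
  if h : τ ∈ Δ.Sbar ∪ Δ.B then (exists_line h).choose else 0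

/-- An affine function cutting out `τ` in the triangle. -/
def phi (Δ : TBA) (τ : Set Pt) (z : Pt) : ℝ := aff (Δ.lineOf τ) z

theorem exists_phi_ne {τ : Set Pt} (h : τ ∈ Δ.Sbar ∪ Δ.B) : ∃ z, Δ.phi τ z ≠ 0 := by
  unfold phi lineOf
  rw [dif_pos h]
  exact (exists_line h).choose_spec.1

theorem mem_iff {τ : Set Pt} (h : τ ∈ Δ.Sbar ∪ Δ.B) (z : Pt) :
    z ∈ τ ↔ z ∈ Δ.tri ∧ Δ.phi τ z = 0 := by
  unfold phi lineOf
  rw [dif_pos h]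
  exact (exists_line h).choose_spec.2 z

end TBA

namespace TBA

variable {Δ : TBA}

theorem phi_lineMap (τ : Set Pt) (u z : Pt) (t : ℝ) :
    Δ.phi τ (u + t • (z - u)) = (1 - t) * Δ.phi τ u + t * Δ.phi τ z :=
  aff_lineMap _ _ _ _

theorem mem_Sbar_iff {s : Set Pt} (h : s ∈ Δ.Sbar) (z : Pt) : z ∈ s ↔ z ∈ Δ.tri ∧ Δ.phi s z = 0 :=
  mem_iff (Or.inl h) z

theorem mem_B_iff {b : Set Pt} (h : b ∈ Δ.B) (z : Pt) : z ∈ b ↔ z ∈ Δ.tri ∧ Δ.phi b z = 0 :=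
  mem_iff (Or.inr h) z

theorem finite_Sbar (Δ : TBA) : Δ.Sbar.Finite :=
  Δ.finS.union (by unfold triEdges; exact Set.toFinite _)

theorem eq_of_two_mem {s t : Set Pt} (hs : s ∈ Δ.Sbar ∪ Δ.B) (ht : t ∈ Δ.Sbar ∪ Δ.B) {u v : Pt}
    (huv : u ≠ v) (hus : u ∈ s) (hvs : v ∈ s) (hut : u ∈ t) (hvt : v ∈ t) : s = t := by
  ext z
  rw [mem_iff hs] at *
  rw [mem_iff ht] at *
  have := aff_eq_zero_iff_of_ne (exists_phi_ne hs) (exists_phi_ne ht) huv hus.2 hvs.2 hut.2 hvt.2 z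
  unfold phi
  rw [this]

theorem Sbar_inter {s t : Set Pt} (hs : s ∈ Δ.Sbar) (ht : t ∈ Δ.Sbar) (hst : s ≠ t) {u v : Pt}
    (hus : u ∈ s) (hvs : v ∈ s) (hut : u ∈ t) (hvt : v ∈ t) : u = v := by
  by_contra h
  exact hst (eq_of_two_mem (Or.inl hs) (Or.inl ht) h hus hvs hut hvt)

theorem concurrent {s₁ s₂ s₃ : Set Pt} (h₁ : s₁ ∈ Δ.Sbar) (h₂ : s₂ ∈ Δ.Sbar) (h₃ : s₃ ∈ Δ.Sbar)
    {p : Pt} (hp₁ : p ∈ s₁) (hp₂ : p ∈ s₂) (hp₃ : p ∈ s₃) (h12 : s₁ ≠ s₂) : s₃ = s₁ ∨ s₃ = s₂ := by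
  by_contra! h
  exact Δ.no_three_concurrent s₁ h₁ s₂ h₂ s₃ h₃ h12 h.1.symm h.2.symm ⟨p, hp₁, hp₂, hp₃⟩

theorem infinite_of_mem {τ : Set Pt} (hτ : τ ∈ Δ.Sbar ∪ Δ.B) {u v : Pt} (huv : u ≠ v) (hu : u ∈ τ)
    (hv : v ∈ τ) : τ.Infinite := by
  have hinj : Set.InjOn (fun t : ℝ => u + t • (v - u)) (Icc 0 1) := by
    intro a _ b _ hab
    have h : a • (v - u) = b • (v - u) := by simpa using hab
    exact smul_left_injective ℝ (sub_ne_zero.mpr huv.symm) h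
  refine ((Icc_infinite (zero_lt_one' ℝ)).image hinj).mono ?_
  rintro _ ⟨t, ht, rfl⟩
  rw [mem_iff hτ] at hu hv ⊢
  refine ⟨add_smul_mem_tri hu.1 hv.1 ht.1 ht.2, ?_⟩
  rw [phi_lineMap, hu.2, hv.2]; ring

theorem block_ne_Sbar {b s : Set Pt} (hb : b ∈ Δ.B) (hs : s ∈ Δ.Sbar) : b ≠ s := by
  rintro rfl
  obtain ⟨u, v, huv, hseg, -⟩ := Δ.seg_wf b (Or.inr hb)
  have hinf : b.Infinite := infinite_of_mem (Or.inr hb) huv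
    (hseg ▸ left_mem_segment _ _ _) (hseg ▸ right_mem_segment _ _ _)
  apply hinf
  have hfin : (⋃ s' ∈ Δ.Sbar \ {b}, b ∩ s').Finite := by
    refine (Δ.finite_Sbar.subset sdiff_subset).biUnion fun s' hs' => ?_
    apply Set.Subsingleton.finite
    intro x hx y hy
    exact Sbar_inter hs hs'.1 (fun h => hs'.2 h.symm) hx.1 hy.1 hx.2 hy.2
  refine hfin.subset fun p hp => ?_
  obtain ⟨s', ⟨h1, h2, h3⟩, -⟩ := Δ.second_segment b hs b hb p hp hp
  simp only [mem_iUnion]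
  exact ⟨s', ⟨h1, h2⟩, hp, h3⟩

theorem block_inter {b s : Set Pt} (hb : b ∈ Δ.B) (hs : s ∈ Δ.Sbar) {u v : Pt}
    (hub : u ∈ b) (hvb : v ∈ b) (hus : u ∈ s) (hvs : v ∈ s) : u = v := by
  by_contra h
  exact block_ne_Sbar hb hs (eq_of_two_mem (Or.inr hb) (Or.inl hs) h hub hvb hus hvs)

theorem not_edge_of_mem_S {s : Set Pt} (hs : s ∈ Δ.S) (i : Fin 3) : s ≠ Δ.edge i := by
  rintro rfl
  exact not_mem_edges_of_mem_S (Or.inl hs) (Δ.edge_mem i)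

theorem bary_nonneg {z : Pt} (hz : z ∈ Δ.tri) (i : Fin 3) : 0 ≤ aff (Δ.bary i) z :=
  (Δ.mem_tri_iff z).mp hz i

theorem bary_le_one {z : Pt} (hz : z ∈ Δ.tri) (i : Fin 3) : aff (Δ.bary i) z ≤ 1 := by
  have h := Δ.sum_bary z
  have h0 := bary_nonneg hz 0
  have h1 := bary_nonneg hz 1
  have h2 := bary_nonneg hz 2
  have : i = 0 ∨ i = 1 ∨ i = 2 := by revert i; decide
  rcases this with rfl | rfl | rfl <;> linarith

theorem eq_edge_of_bary_eq_zero {s t : Set Pt} (hs : s ∈ Δ.Sbar) (ht : t ∈ Δ.Sbar) (hst : s ≠ t)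
    {u : Pt} (hus : u ∈ s) (hut : u ∈ t) {i : Fin 3} (hi : aff (Δ.bary i) u = 0) :
    Δ.edge i = s ∨ Δ.edge i = t :=
  concurrent hs ht (Δ.edge_mem_Sbar i) hus hut ⟨((mem_Sbar_iff hs u).mp hus).1, hi⟩ hst

theorem bary_pos_of_mem_S {s t : Set Pt} (hs : s ∈ Δ.S) (ht : t ∈ Δ.S) (hst : s ≠ t)
    {u : Pt} (hus : u ∈ s) (hut : u ∈ t) (i : Fin 3) : 0 < aff (Δ.bary i) u := by
  refine (bary_nonneg ((mem_Sbar_iff (Or.inl hs) u).mp hus).1 i).lt_of_ne' fun h => ?_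
  rcases eq_edge_of_bary_eq_zero (Or.inl hs) (Or.inl ht) hst hus hut h with h | h
  · exact not_edge_of_mem_S hs i h.symm
  · exact not_edge_of_mem_S ht i h.symm

/-- A segment of the triangle can be prolonged beyond an endpoint that lies only on those edges
that contain the segment. -/
theorem exists_prolong {u z : Pt} (hz : z ∈ Δ.tri)
    (h : ∀ i, 0 < aff (Δ.bary i) u ∨ aff (Δ.bary i) u = 0 ∧ aff (Δ.bary i) z = 0) :
    ∃ ε : ℝ, 0 < ε ∧ u + (-ε) • (z - u) ∈ Δ.tri := by
  have h1 : ∀ i, ∃ m : ℝ, 0 < m ∧ ∀ ε, 0 < ε → ε ≤ m → 0 ≤ aff (Δ.bary i) (u + (-ε) • (z - u)) := by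
    intro i
    have hz1 := bary_le_one hz i
    rcases h i with h | ⟨h, h'⟩
    · refine ⟨aff (Δ.bary i) u, h, fun ε h0 hε => ?_⟩
      rw [aff_lineMap]
      nlinarith [mul_nonneg h0.le (sub_nonneg.mpr hz1), mul_nonneg h0.le h.le]
    · refine ⟨1, one_pos, fun ε _ _ => ?_⟩
      rw [aff_lineMap, h, h']; simp
  choose m hm hm' using h1
  refine ⟨min (m 0) (min (m 1) (m 2)), ?_, ?_⟩
  · simp [hm]
  · rw [Δ.mem_tri_iff]
    intro i
    refine hm' i _ (by simp [hm]) ?_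
    have : i = 0 ∨ i = 1 ∨ i = 2 := by revert i; decide
    rcases this with rfl | rfl | rfl <;> simp

theorem same_side_of_edge {s : Set Pt} (hs : s ∈ triEdges Δ.x1 Δ.x2 Δ.x3) {z w : Pt}
    (hz : z ∈ Δ.tri) (hw : w ∈ Δ.tri) (hzs : Δ.phi s z ≠ 0) (hws : Δ.phi s w ≠ 0) :
    0 < Δ.phi s z * Δ.phi s w := by
  by_contra! hle
  have hlt : Δ.phi s z * Δ.phi s w < 0 := hle.lt_of_ne (mul_ne_zero hzs hws)
  obtain ⟨t, h0, h1, ht⟩ := exists_aff_eq_zero hlt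
  have hm : z + t • (w - z) ∈ s :=
    (mem_Sbar_iff (Or.inr hs) _).mpr ⟨add_smul_mem_tri hz hw h0.le h1.le, ht⟩
  obtain ⟨i, rfl⟩ := Δ.exists_eq_edge hs
  have h := hm.2
  rw [aff_lineMap] at h
  have hzi := bary_nonneg hz i
  have hwi := bary_nonneg hw i
  have : aff (Δ.bary i) z = 0 := by
    nlinarith [mul_nonneg (sub_nonneg.mpr h1.le) hzi, mul_nonneg h0.le hwi]
  exact hzs ((mem_Sbar_iff (Or.inr hs) z).mp ⟨hz, this⟩).2

theorem mem_S_of_crosses {s : Set Pt} (hs : s ∈ Δ.Sbar) {z w : Pt}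
    (hz : z ∈ Δ.tri) (hw : w ∈ Δ.tri) (h : Δ.phi s z * Δ.phi s w < 0) : s ∈ Δ.S := by
  refine hs.resolve_right fun he => ?_
  have := same_side_of_edge he hz hw (left_ne_zero_of_mul h.ne) (right_ne_zero_of_mul h.ne)
  linarith

theorem exists_ne_mem {τ : Set Pt} (hτ : τ ∈ Δ.Sbar ∪ Δ.B) (u : Pt) : ∃ z ∈ τ, z ≠ u := by
  have : ∃ a b : Pt, a ≠ b ∧ a ∈ τ ∧ b ∈ τ := by
    have hx : ∀ i j : Fin 3, i ≠ j → ![Δ.x1, Δ.x2, Δ.x3] i ≠ ![Δ.x1, Δ.x2, Δ.x3] j :=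
      fun i j hij h => hij (Δ.indep.injective h)
    have key : τ ∈ triEdges Δ.x1 Δ.x2 Δ.x3 ∨ τ ∈ Δ.S ∪ Δ.B := by
      rcases hτ with (h | h) | h
      · exact Or.inr (Or.inl h)
      · exact Or.inl h
      · exact Or.inr (Or.inr h)
    rcases key with h | h
    · simp only [triEdges, mem_insert_iff, mem_singleton_iff] at h
      rcases h with rfl | rfl | rfl
      · exact ⟨_, _, hx 0 1 (by decide), left_mem_segment _ _ _, right_mem_segment _ _ _⟩
      · exact ⟨_, _, hx 1 2 (by decide), left_mem_segment _ _ _, right_mem_segment _ _ _⟩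
      · exact ⟨_, _, hx 2 0 (by decide), left_mem_segment _ _ _, right_mem_segment _ _ _⟩
    · obtain ⟨a, b, hab, rfl, -⟩ := Δ.seg_wf τ h
      exact ⟨a, b, hab, left_mem_segment _ _ _, right_mem_segment _ _ _⟩
  obtain ⟨a, b, hab, ha, hb⟩ := this
  by_cases h : a = u
  · exact ⟨b, hb, fun h' => hab (h.trans h'.symm)⟩
  · exact ⟨a, ha, h⟩

theorem add_smul_inj {u z : Pt} (h : z ≠ u) {a b : ℝ} (hab : u + a • (z - u) = u + b • (z - u)) :
    a = b :=
  smul_left_injective ℝ (sub_ne_zero.mpr h) (by simpa using hab)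

/-- A point beyond `z` on the ray from `u` through `z`, lying on an edge of the triangle. -/
theorem exists_exit {u z : Pt} (hu : u ∈ Δ.tri) (hz : z ∈ Δ.tri) (huz : z ≠ u) :
    ∃ μ : ℝ, 0 < μ ∧ ∃ i, aff (Δ.bary i) z < aff (Δ.bary i) u ∧ u + μ • (z - u) ∈ Δ.edge i := by
  set g : Fin 3 → Pt → ℝ := fun i => aff (Δ.bary i) with hg
  have hex : ∃ i, g i z < g i u := by
    by_contra! hc
    apply huz
    apply Δ.eq_of_bary
    have h1 := Δ.sum_bary z
    have h2 := Δ.sum_bary u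
    have h3 := hc 0
    have h4 := hc 1
    have h5 := hc 2
    simp only [hg] at h3 h4 h5
    intro i
    have : i = 0 ∨ i = 1 ∨ i = 2 := by revert i; decide
    rcases this with rfl | rfl | rfl <;> linarith
  obtain ⟨i₀, hi₀⟩ := hex
  obtain ⟨i, hi, hmin⟩ := Finset.exists_min_image (Finset.univ.filter fun i => g i z < g i u)
    (fun i => g i u / (g i u - g i z)) ⟨i₀, by simp [hi₀]⟩
  simp only [Finset.mem_filter, Finset.mem_univ, true_and] at hi hmin
  have hzi : ∀ j, 0 ≤ g j z := bary_nonneg hz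
  have hui : ∀ j, 0 ≤ g j u := bary_nonneg hu
  have hpos : 0 < g i u := (hzi i).trans_lt hi
  have hd : 0 < g i u - g i z := by linarith
  set μ := g i u / (g i u - g i z) with hμ
  have hμ0 : 0 < μ := div_pos hpos hd
  refine ⟨μ, hμ0, i, hi, ?_, ?_⟩
  · rw [Δ.mem_tri_iff]
    intro j
    rw [aff_lineMap]
    change 0 ≤ (1 - μ) * g j u + μ * g j z
    by_cases hj : g j z < g j u
    · have h1 := hmin j hj
      rw [le_div_iff₀ (by linarith)] at h1
      linarith
    · push Not at hj
      nlinarith [hui j, mul_nonneg hμ0.le (sub_nonneg.mpr hj)]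
  · rw [aff_lineMap]
    change (1 - μ) * g i u + μ * g i z = 0
    rw [hμ]; field_simp; ring

/-- The next vertex along an initial segment. -/
theorem exists_next {s : Set Pt} (hs : s ∈ Δ.Sbar) {u z : Pt} (hu : u ∈ s) (hz : z ∈ s)
    (huz : z ≠ u) : ∃ μ : ℝ, 0 < μ ∧ u + μ • (z - u) ∈ s ∧
      (∃ s' ∈ Δ.Sbar, s' ≠ s ∧ u + μ • (z - u) ∈ s') ∧
      ∀ ν, 0 < ν → ν < μ → ∀ σ ∈ Δ.Sbar, σ ≠ s → u + ν • (z - u) ∉ σ := by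
  have hu' := (mem_Sbar_iff hs u).mp hu
  have hz' := (mem_Sbar_iff hs z).mp hz
  have hline : ∀ (ν : ℝ) (σ), σ ∈ Δ.Sbar → u + ν • (z - u) ∈ σ → u + ν • (z - u) ∈ s := by
    intro ν σ hσ h
    rw [mem_Sbar_iff hs]
    refine ⟨((mem_Sbar_iff hσ _).mp h).1, ?_⟩
    rw [phi_lineMap, hu'.2, hz'.2]; ring
  set P : Set ℝ := {ν | 0 < ν ∧ ∃ s' ∈ Δ.Sbar, s' ≠ s ∧ u + ν • (z - u) ∈ s'} with hP
  have hfin : P.Finite := by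
    have : (⋃ s' ∈ Δ.Sbar \ {s}, {ν : ℝ | u + ν • (z - u) ∈ s'}).Finite := by
      refine (Δ.finite_Sbar.subset sdiff_subset).biUnion fun s' hs' => ?_
      apply Set.Subsingleton.finite
      intro a ha b hb
      exact add_smul_inj huz (Sbar_inter hs'.1 hs hs'.2 ha hb (hline _ _ hs'.1 ha)
        (hline _ _ hs'.1 hb))
    refine this.subset fun ν hν => ?_
    obtain ⟨-, s', h1, h2, h3⟩ := hν
    simp only [mem_iUnion]
    exact ⟨s', ⟨h1, h2⟩, h3⟩
  have hne : P.Nonempty := by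
    obtain ⟨μ, hμ, i, hi, hmem⟩ := exists_exit hu'.1 hz'.1 huz
    refine ⟨μ, hμ, Δ.edge i, Δ.edge_mem_Sbar i, ?_, hmem⟩
    rintro rfl
    rw [hu.2, hz.2] at hi
    exact lt_irrefl _ hi
  obtain ⟨μ, ⟨hμ, s', h1, h2, h3⟩, hmin⟩ := Set.exists_min_image P id hfin hne
  refine ⟨μ, hμ, hline _ _ h1 h3, ⟨s', h1, h2, h3⟩, ?_⟩
  intro ν h0 hνμ σ hσ hσs hmem
  exact absurd (hmin ν ⟨h0, σ, hσ, hσs, hmem⟩) (not_le.mpr hνμ)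

/-- The open segment `uw`, contained in `s`, meets no other initial segment. -/
def Free (Δ : TBA) (s : Set Pt) (u w : Pt) : Prop :=
  ∀ ν : ℝ, 0 < ν → ν < 1 → ∀ σ ∈ Δ.Sbar, σ ≠ s → u + ν • (w - u) ∉ σ

theorem Free.symm {s : Set Pt} {u w : Pt} (h : Δ.Free s u w) : Δ.Free s w u := by
  intro ν h0 h1 σ hσ hσs hm
  refine h (1 - ν) (by linarith) (by linarith) σ hσ hσs ?_
  convert hm using 1; module

theorem exists_next_free {s : Set Pt} (hs : s ∈ Δ.Sbar) {u z : Pt} (hu : u ∈ s) (hz : z ∈ s)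
    (huz : z ≠ u) : ∃ μ : ℝ, 0 < μ ∧ u + μ • (z - u) ∈ s ∧
      (∃ s' ∈ Δ.Sbar, s' ≠ s ∧ u + μ • (z - u) ∈ s') ∧ Δ.Free s u (u + μ • (z - u)) := by
  obtain ⟨μ, hμ, h1, h2, h3⟩ := exists_next hs hu hz huz
  refine ⟨μ, hμ, h1, h2, fun ν h0 hν σ hσ hσs hm =>
    h3 (ν * μ) (by positivity) (by nlinarith) σ hσ hσs ?_⟩
  convert hm using 1; module

theorem phi_ne_zero {s t : Set Pt} (hs : s ∈ Δ.Sbar) (ht : t ∈ Δ.Sbar) (hst : s ≠ t) {u z : Pt}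
    (hus : u ∈ s) (hut : u ∈ t) (hz : z ∈ t) (huz : z ≠ u) : Δ.phi s z ≠ 0 := fun h =>
  huz (Sbar_inter hs ht hst ((mem_Sbar_iff hs z).mpr ⟨((mem_Sbar_iff ht z).mp hz).1, h⟩) hus hz hut)

/-- Turning from `s` into `t` at `u`, towards the side of `s` containing `z₀`. -/
theorem exists_turn {s t : Set Pt} (hs : s ∈ Δ.Sbar) (ht : t ∈ Δ.Sbar) (hst : s ≠ t) {u z₀ : Pt}
    (hus : u ∈ s) (hut : u ∈ t) (hz₀ : z₀ ∈ Δ.tri) (h₀ : Δ.phi s z₀ ≠ 0) :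
    ∃ w ∈ t, w ≠ u ∧ 0 < Δ.phi s w * Δ.phi s z₀ ∧ Δ.Free t u w ∧
      ∃ r ∈ Δ.Sbar, r ≠ t ∧ w ∈ r := by
  have huT := ((mem_Sbar_iff hs u).mp hus)
  have hut' := ((mem_Sbar_iff ht u).mp hut)
  have hz : ∃ z ∈ t, z ≠ u ∧ 0 < Δ.phi s z * Δ.phi s z₀ := by
    obtain ⟨z, hzt, hzu⟩ := exists_ne_mem (Or.inl ht) u
    have hzT := ((mem_Sbar_iff ht z).mp hzt)
    have hne : Δ.phi s z ≠ 0 := phi_ne_zero hs ht hst hus hut hzt hzu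
    by_cases hpos : 0 < Δ.phi s z * Δ.phi s z₀
    · exact ⟨z, hzt, hzu, hpos⟩
    have hlt : Δ.phi s z * Δ.phi s z₀ < 0 :=
      (not_lt.mp hpos).lt_of_ne (mul_ne_zero hne h₀)
    have hsS : s ∈ Δ.S := mem_S_of_crosses hs hzT.1 hz₀ hlt
    obtain ⟨ε, hε, hmem⟩ := exists_prolong (Δ := Δ) (u := u) hzT.1 (by
      intro i
      rcases (bary_nonneg huT.1 i).lt_or_eq with h | h
      · exact Or.inl h
      · right
        refine ⟨h.symm, ?_⟩
        rcases eq_edge_of_bary_eq_zero hs ht hst hus hut h.symm with h' | h'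
        · exact absurd h'.symm (not_edge_of_mem_S hsS i)
        · rw [← h'] at hzt
          exact hzt.2)
    refine ⟨u + (-ε) • (z - u), ?_, ?_, ?_⟩
    · rw [mem_Sbar_iff ht]
      refine ⟨hmem, ?_⟩
      rw [phi_lineMap, hut'.2, hzT.2]; ring
    · intro h
      have := add_smul_inj hzu (a := -ε) (b := 0) (by rw [h]; simp)
      linarith
    · rw [phi_lineMap, huT.2]
      nlinarith
  obtain ⟨z, hzt, hzu, hpos⟩ := hz
  obtain ⟨μ, hμ, h1, h2, h3⟩ := exists_next_free ht hut hzt hzu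
  refine ⟨_, h1, ?_, ?_, h3, h2⟩
  · intro h
    have := add_smul_inj hzu (a := μ) (b := 0) (by rw [h]; simp)
    linarith
  · rw [phi_lineMap, huT.2]
    nlinarith

end TBA

namespace TBA

variable {Δ : TBA}

theorem continuous_phi (Δ : TBA) (τ : Set Pt) : Continuous (Δ.phi τ) := continuous_aff _

theorem exists_param {τ : Set Pt} (hτ : τ ∈ Δ.Sbar ∪ Δ.B) {u v z : Pt} (huv : u ≠ v) (hu : u ∈ τ)
    (hv : v ∈ τ) (hz : z ∈ τ) : ∃ t : ℝ, z = u + t • (v - u) := by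
  obtain ⟨x, hx⟩ := exists_phi_ne hτ
  rw [mem_iff hτ] at hu hv hz
  have h0 : crs (v - u) (z - u) = 0 := by
    by_contra h
    exact hx (aff_eq_zero_of_noncollinear hu.2 hv.2 hz.2 h x)
  obtain ⟨t, ht⟩ := exists_of_crs_eq_zero (sub_ne_zero.mpr huv.symm) h0
  exact ⟨t, by rw [← ht]; abel⟩

theorem mem_affineSpan_pair_iff {τ : Set Pt} (hτ : τ ∈ Δ.Sbar ∪ Δ.B) {u v z : Pt} (huv : u ≠ v)
    (hu : u ∈ τ) (hv : v ∈ τ) (hz : z ∈ Δ.tri) :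
    z ∈ affineSpan ℝ ({u, v} : Set Pt) ↔ z ∈ τ := by
  rw [_root_.mem_affineSpan_pair_iff_exists_lineMap_eq]
  constructor
  · rintro ⟨t, rfl⟩
    rw [mem_iff hτ]
    refine ⟨hz, ?_⟩
    rw [mem_iff hτ] at hu hv
    have := phi_lineMap (Δ := Δ) τ u v t
    rw [hu.2, hv.2] at this
    rw [AffineMap.lineMap_apply]
    simp only [vsub_eq_sub, vadd_eq_add]
    rw [add_comm, this]; ring
  · intro h
    obtain ⟨t, rfl⟩ := exists_param hτ huv hu hv h
    exact ⟨t, by rw [AffineMap.lineMap_apply]; simp [add_comm]⟩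

theorem Sbar_cross_of_free {s : Set Pt} {u w : Pt} (hu : u ∈ Δ.tri) (hw : w ∈ Δ.tri)
    (h : Δ.Free s u w) {σ : Set Pt} (hσ : σ ∈ Δ.Sbar) (hσs : σ ≠ s) :
    0 ≤ Δ.phi σ u * Δ.phi σ w := by
  by_contra! hlt
  obtain ⟨t, h0, h1, ht⟩ := exists_aff_eq_zero hlt
  exact h t h0 h1 σ hσ hσs ((mem_Sbar_iff hσ _).mpr ⟨add_smul_mem_tri hu hw h0.le h1.le, ht⟩)

theorem block_cross_of_free {s : Set Pt} (hs : s ∈ Δ.Sbar) {u w : Pt} (hu : u ∈ s) (hw : w ∈ s)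
    (h : Δ.Free s u w) {b : Set Pt} (hb : b ∈ Δ.B) : 0 ≤ Δ.phi b u * Δ.phi b w := by
  by_contra! hlt
  obtain ⟨t, h0, h1, ht⟩ := exists_aff_eq_zero hlt
  rw [mem_Sbar_iff hs] at hu hw
  have hT := add_smul_mem_tri hu.1 hw.1 h0.le h1.le
  have hms : u + t • (w - u) ∈ s := by
    rw [mem_Sbar_iff hs, phi_lineMap, hu.2, hw.2]
    exact ⟨hT, by ring⟩
  obtain ⟨σ, ⟨h2, h3, h4⟩, -⟩ :=
    Δ.second_segment s hs b hb _ hms ((mem_B_iff hb _).mpr ⟨hT, ht⟩)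
  exact h t h0 h1 σ h2 h3 h4

/-- The open cell of the arrangement containing `z₀`. -/
def cell (Δ : TBA) (z₀ : Pt) : Set Pt :=
  {z | z ∈ Δ.tri ∧ ∀ τ ∈ Δ.Sbar, 0 < Δ.phi τ z * Δ.phi τ z₀}

/-- The closed cell of the arrangement containing `z₀`. -/
def closedCell (Δ : TBA) (z₀ : Pt) : Set Pt :=
  {z | z ∈ Δ.tri ∧ ∀ τ ∈ Δ.Sbar, 0 ≤ Δ.phi τ z * Δ.phi τ z₀}

theorem add_smul_mem_cell {z₀ z : Pt} (h₀ : z₀ ∈ Δ.cell z₀) (hz : z ∈ Δ.closedCell z₀) {t : ℝ}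
    (h0 : 0 < t) (h1 : t ≤ 1) : z + t • (z₀ - z) ∈ Δ.cell z₀ := by
  refine ⟨add_smul_mem_tri hz.1 h₀.1 h0.le h1, fun τ hτ => ?_⟩
  rw [phi_lineMap]
  nlinarith [mul_nonneg (sub_nonneg.mpr h1) (hz.2 τ hτ), mul_pos h0 (h₀.2 τ hτ)]

theorem convex_cell (Δ : TBA) (z₀ : Pt) : Convex ℝ (Δ.cell z₀) := by
  rw [convex_iff_add_mem]
  intro u hu v hv a b ha hb hab
  refine ⟨Δ.convex_tri hu.1 hv.1 ha hb hab, fun τ hτ => ?_⟩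
  have ha' : a = 1 - b := by linarith
  have : a • u + b • v = u + b • (v - u) := by rw [ha']; module
  rw [this, phi_lineMap, ← ha', add_mul, mul_assoc, mul_assoc]
  rcases ha.eq_or_lt with h | h
  · have : b = 1 := by linarith
    rw [← h, this]; simpa using hv.2 τ hτ
  · exact add_pos_of_pos_of_nonneg (mul_pos h (hu.2 τ hτ)) (mul_nonneg hb (hv.2 τ hτ).le)

theorem convex_closedCell (Δ : TBA) (z₀ : Pt) : Convex ℝ (Δ.closedCell z₀) := by
  rw [convex_iff_add_mem]
  intro u hu v hv a b ha hb hab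
  refine ⟨Δ.convex_tri hu.1 hv.1 ha hb hab, fun τ hτ => ?_⟩
  have ha' : a = 1 - b := by linarith
  have : a • u + b • v = u + b • (v - u) := by rw [ha']; module
  rw [this, phi_lineMap, ← ha', add_mul, mul_assoc, mul_assoc]
  exact add_nonneg (mul_nonneg ha (hu.2 τ hτ)) (mul_nonneg hb (hv.2 τ hτ))

theorem isClosed_closedCell (Δ : TBA) (z₀ : Pt) : IsClosed (Δ.closedCell z₀) := by
  have : Δ.closedCell z₀ = Δ.tri ∩ ⋂ τ ∈ Δ.Sbar, {z | 0 ≤ Δ.phi τ z * Δ.phi τ z₀} := by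
    ext z; simp [closedCell]
  rw [this]
  exact Δ.isClosed_tri.inter (isClosed_biInter fun τ _ =>
    isClosed_le continuous_const ((Δ.continuous_phi τ).mul continuous_const))

theorem closure_cell {z₀ : Pt} (h₀ : z₀ ∈ Δ.cell z₀) :
    closure (Δ.cell z₀) = Δ.closedCell z₀ := by
  apply subset_antisymm
  · exact closure_minimal (fun z hz => ⟨hz.1, fun τ hτ => (hz.2 τ hτ).le⟩)
      (isClosed_closedCell Δ z₀)
  · intro z hz
    have hsub : openSegment ℝ z z₀ ⊆ Δ.cell z₀ := by
      rw [openSegment_eq_image']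
      rintro _ ⟨t, ht, rfl⟩
      exact add_smul_mem_cell h₀ hz ht.1 ht.2.le
    exact closure_mono hsub (segment_subset_closure_openSegment (left_mem_segment _ _ _))

theorem isMinRegion_closedCell {z₀ : Pt} (h₀ : z₀ ∈ Δ.cell z₀) :
    Δ.IsMinRegion (Δ.closedCell z₀) := by
  have hsub : Δ.cell z₀ ⊆ Δ.tri \ ⋃₀ Δ.Sbar := by
    intro z hz
    refine ⟨hz.1, ?_⟩
    rintro ⟨τ, hτ, hzτ⟩
    have := hz.2 τ hτ
    rw [((mem_Sbar_iff hτ z).mp hzτ).2] at this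
    simp at this
  refine ⟨z₀, hsub h₀, ?_⟩
  rw [← closure_cell h₀]
  congr 1
  apply subset_antisymm
  · exact (convex_cell Δ z₀).isPreconnected.subset_connectedComponentIn h₀ hsub
  · intro z hz
    have hF := connectedComponentIn_subset _ _ hz
    refine ⟨hF.1, fun τ hτ => ?_⟩
    by_contra! hle
    have hpre : IsPreconnected (connectedComponentIn (Δ.tri \ ⋃₀ Δ.Sbar) z₀) :=
      isPreconnected_connectedComponentIn
    have hcont : ContinuousOn (fun x => Δ.phi τ x * Δ.phi τ z₀)
        (connectedComponentIn (Δ.tri \ ⋃₀ Δ.Sbar) z₀) :=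
      ((Δ.continuous_phi τ).mul continuous_const).continuousOn
    obtain ⟨x, hx, hx0⟩ := hpre.intermediate_value hz (mem_connectedComponentIn (hsub h₀)) hcont
      ⟨hle, (h₀.2 τ hτ).le⟩
    have hxF := connectedComponentIn_subset _ _ hx
    have hne : Δ.phi τ z₀ ≠ 0 := right_ne_zero_of_mul (h₀.2 τ hτ).ne'
    exact hxF.2 ⟨τ, hτ, (mem_Sbar_iff hτ x).mpr ⟨hxF.1, (mul_eq_zero.mp hx0).resolve_right hne⟩⟩

theorem mem_frontier_closedCell {z₀ x : Pt} (h₀ : z₀ ∈ Δ.cell z₀) (hx : x ∈ Δ.closedCell z₀)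
    {τ : Set Pt} (hτ : τ ∈ Δ.Sbar) (hxτ : x ∈ τ) : x ∈ frontier (Δ.closedCell z₀) := by
  refine ⟨subset_closure hx, fun hint => ?_⟩
  have hopen : IsOpen ((fun t : ℝ => x + t • (z₀ - x)) ⁻¹' interior (Δ.closedCell z₀)) :=
    isOpen_interior.preimage (by fun_prop)
  obtain ⟨ε, hε, hball⟩ := Metric.isOpen_iff.mp hopen 0 (by simpa using hint)
  have hmem := interior_subset (hball (show -(ε / 2) ∈ Metric.ball (0 : ℝ) ε by
    rw [Metric.mem_ball, Real.dist_eq, sub_zero, abs_neg, abs_of_pos (by positivity)]; linarith))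
  have h1 := hmem.2 τ hτ
  rw [phi_lineMap, ((mem_Sbar_iff hτ x).mp hxτ).2] at h1
  nlinarith [h₀.2 τ hτ]

theorem mem_interior_closedCell {z₀ : Pt} (h₀ : z₀ ∈ Δ.cell z₀) :
    z₀ ∈ interior (Δ.closedCell z₀) := by
  rw [mem_interior]
  refine ⟨(⋂ i, {z | 0 < aff (Δ.bary i) z}) ∩ ⋂ τ ∈ Δ.Sbar, {z | 0 < Δ.phi τ z * Δ.phi τ z₀},
    ?_, ?_, ?_⟩
  · rintro z ⟨h1, h2⟩
    simp only [mem_iInter] at h1 h2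
    exact ⟨(Δ.mem_tri_iff z).mpr fun i => (h1 i).le, fun τ hτ => (h2 τ hτ).le⟩
  · exact (isOpen_iInter_of_finite fun i => isOpen_lt continuous_const (continuous_aff _)).inter
      (Δ.finite_Sbar.isOpen_biInter fun τ _ =>
        isOpen_lt continuous_const ((Δ.continuous_phi τ).mul continuous_const))
  · simp only [mem_inter_iff, mem_iInter]
    refine ⟨fun i => (bary_nonneg h₀.1 i).lt_of_ne' fun h => ?_, h₀.2⟩
    have h1 := h₀.2 _ (Δ.edge_mem_Sbar i)
    rw [((mem_Sbar_iff (Δ.edge_mem_Sbar i) z₀).mp ⟨h₀.1, h⟩).2] at h1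
    simp at h1

theorem segment_subset_frontier {z₀ : Pt} (h₀ : z₀ ∈ Δ.cell z₀) {s : Set Pt} (hs : s ∈ Δ.Sbar)
    {u w : Pt} (hu : u ∈ Δ.closedCell z₀) (hw : w ∈ Δ.closedCell z₀) (hus : u ∈ s) (hws : w ∈ s) :
    segment ℝ u w ⊆ s ∩ frontier (Δ.closedCell z₀) := by
  intro x hx
  have hK := (convex_closedCell Δ z₀).segment_subset hu hw hx
  have hxs : x ∈ s := by
    rw [segment_eq_image'] at hx
    obtain ⟨t, ht, rfl⟩ := hx
    rw [mem_Sbar_iff hs] at hus hws ⊢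
    refine ⟨hK.1, ?_⟩
    rw [phi_lineMap, hus.2, hws.2]; ring
  exact ⟨hxs, mem_frontier_closedCell h₀ hK hs hxs⟩

/-- Every vertex of a closed cell is followed by a next one. -/
theorem exists_next_closedCell {z₀ : Pt} (h₀ : z₀ ∈ Δ.cell z₀) {s t : Set Pt} (hs : s ∈ Δ.Sbar)
    (ht : t ∈ Δ.Sbar) (hst : s ≠ t) {u : Pt} (hu : u ∈ Δ.closedCell z₀) (hus : u ∈ s)
    (hut : u ∈ t) : ∃ w ∈ t, w ≠ u ∧ w ∈ Δ.closedCell z₀ ∧ Δ.Free t u w ∧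
      ∃ r ∈ Δ.Sbar, r ≠ t ∧ w ∈ r := by
  obtain ⟨w, hwt, hwu, hpos, hfree, hr⟩ := exists_turn hs ht hst hus hut h₀.1
    (right_ne_zero_of_mul (h₀.2 s hs).ne')
  have hwT := (mem_Sbar_iff ht w).mp hwt
  refine ⟨w, hwt, hwu, ⟨hwT.1, fun σ hσ => ?_⟩, hfree, hr⟩
  by_cases h1 : σ = t
  · rw [h1, hwT.2]; simp
  by_cases h2 : σ = s
  · rw [h2]; exact hpos.le
  have h3 := Sbar_cross_of_free hu.1 hwT.1 hfree hσ h1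
  have h4 : Δ.phi σ u ≠ 0 := fun h => by
    rcases concurrent hs ht hσ hus hut ((mem_Sbar_iff hσ u).mpr ⟨hu.1, h⟩) hst with h | h
    · exact h2 h
    · exact h1 h
  have h5 := hu.2 σ hσ
  have h6 := h₀.2 σ hσ
  by_contra! hlt
  have h7 : Δ.phi σ u * Δ.phi σ z₀ ≠ 0 := mul_ne_zero h4 (right_ne_zero_of_mul h6.ne')
  have h8 : 0 < Δ.phi σ u * Δ.phi σ z₀ := h5.lt_of_ne' h7
  have h9 := mul_neg_of_pos_of_neg h8 hlt
  have h10 : 0 ≤ (Δ.phi σ u * Δ.phi σ w) * (Δ.phi σ z₀ * Δ.phi σ z₀) := mul_nonneg h3 h6.le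
  nlinarith

theorem isRegionVertex_closedCell {z₀ : Pt} (h₀ : z₀ ∈ Δ.cell z₀) {s t : Set Pt}
    (hs : s ∈ Δ.Sbar) (ht : t ∈ Δ.Sbar) (hst : s ≠ t) {u v w : Pt} (hu : u ∈ Δ.closedCell z₀)
    (hv : v ∈ Δ.closedCell z₀) (hw : w ∈ Δ.closedCell z₀) (huv : u ≠ v) (hvw : v ≠ w) (hus : u ∈ s)
    (hvs : v ∈ s) (hvt : v ∈ t) (hwt : w ∈ t) : Δ.IsRegionVertex (Δ.closedCell z₀) v :=
  ⟨hv, s, hs, t, ht, hst, hvs, hvt,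
    ⟨u, v, huv, segment_subset_frontier h₀ hs hu hv hus hvs⟩,
    ⟨v, w, hvw, segment_subset_frontier h₀ ht hv hw hvt hwt⟩⟩

/-- In a strong arrangement, if the blocking segment through `v₃` separates the neighbouring
vertices `v₂` and `v₄` and meets the next segment `s₁` at `q`, then `q` lies on `s₄`. -/
theorem Strong.mem_of_mem (hΔ : Δ.Strong) {s₁ s₂ s₃ s₄ : Set Pt} (h₁ : s₁ ∈ Δ.Sbar)
    (h₂ : s₂ ∈ Δ.Sbar) (h₃ : s₃ ∈ Δ.Sbar) (h₄ : s₄ ∈ Δ.Sbar) (h12 : s₁ ≠ s₂) (h23 : s₂ ≠ s₃)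
    (h34 : s₃ ≠ s₄) {v₂ v₃ v₄ : Pt} (hv₂s₁ : v₂ ∈ s₁) (hv₂s₂ : v₂ ∈ s₂) (hv₃s₂ : v₃ ∈ s₂)
    (hv₃s₃ : v₃ ∈ s₃) (hv₄s₃ : v₄ ∈ s₃) (hv₄s₄ : v₄ ∈ s₄) (hv32 : v₂ ≠ v₃) (hv34 : v₄ ≠ v₃)
    (hf₂ : Δ.Free s₂ v₃ v₂) (hf₄ : Δ.Free s₃ v₃ v₄) {b : Set Pt} (hb : b ∈ Δ.B) (hv₃b : v₃ ∈ b)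
    (hsep : Δ.phi b v₂ * Δ.phi b v₄ < 0) {q : Pt} (hqb : q ∈ b) (hqs₁ : q ∈ s₁) : q ∈ s₄ := by
  by_cases h14 : s₁ = s₄
  · exact h14 ▸ hqs₁
  have e₂ := (mem_Sbar_iff h₂ v₂).mp hv₂s₂
  have e₃ := (mem_Sbar_iff h₂ v₃).mp hv₃s₂
  have e₃' := (mem_Sbar_iff h₃ v₃).mp hv₃s₃
  have e₄ := (mem_Sbar_iff h₃ v₄).mp hv₄s₃
  have n₂ : Δ.phi s₃ v₂ ≠ 0 := phi_ne_zero h₃ h₂ h23.symm hv₃s₃ hv₃s₂ hv₂s₂ hv32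
  have n₄ : Δ.phi s₂ v₄ ≠ 0 := phi_ne_zero h₂ h₃ h23 hv₃s₂ hv₃s₃ hv₄s₃ hv34
  have n₃ : ∀ σ ∈ Δ.Sbar, σ ≠ s₂ → σ ≠ s₃ → Δ.phi σ v₃ ≠ 0 := fun σ hσ hσ₂ hσ₃ h => by
    rcases concurrent h₂ h₃ hσ hv₃s₂ hv₃s₃ ((mem_Sbar_iff hσ v₃).mpr ⟨e₃.1, h⟩) h23 with h | h
    · exact hσ₂ h
    · exact hσ₃ h
  obtain ⟨t, ht0, ht1, htm⟩ := exists_aff_eq_zero hsep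
  set m := v₂ + t • (v₄ - v₂) with hm
  have hmT : m ∈ Δ.tri := add_smul_mem_tri e₂.1 e₄.1 ht0.le ht1.le
  have hm₂ : Δ.phi s₂ m = t * Δ.phi s₂ v₄ := by rw [hm, phi_lineMap, e₂.2]; ring
  have hm₃ : Δ.phi s₃ m = (1 - t) * Δ.phi s₃ v₂ := by rw [hm, phi_lineMap, e₄.2]; ring
  obtain ⟨lam, hlam0, hlam1, hlam⟩ : ∃ lam : ℝ, 0 < lam ∧ lam ≤ 1 ∧
      ∀ σ ∈ Δ.Sbar \ {s₂, s₃}, 0 < Δ.phi σ v₃ * Δ.phi σ (v₃ + lam • (m - v₃)) := by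
    have hev : ∀ᶠ lam in nhds (0 : ℝ), ∀ σ ∈ Δ.Sbar \ {s₂, s₃},
        0 < Δ.phi σ v₃ * Δ.phi σ (v₃ + lam • (m - v₃)) := by
      rw [Filter.eventually_all_finite (Δ.finite_Sbar.subset sdiff_subset)]
      rintro σ ⟨hσ, hσ'⟩
      simp only [mem_insert_iff, mem_singleton_iff, not_or] at hσ'
      have hc : Continuous fun lam : ℝ => Δ.phi σ v₃ * Δ.phi σ (v₃ + lam • (m - v₃)) :=
        continuous_const.mul ((Δ.continuous_phi σ).comp (by fun_prop))
      refine (hc.tendsto 0).eventually_const_lt ?_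
      simpa using mul_self_pos.mpr (n₃ σ hσ hσ'.1 hσ'.2)
    obtain ⟨ε, hε, hball⟩ := Metric.eventually_nhds_iff_ball.mp hev
    refine ⟨min (ε / 2) 1, by positivity, min_le_right _ _, hball _ ?_⟩
    rw [Metric.mem_ball, Real.dist_eq, sub_zero, abs_of_pos (by positivity)]
    exact (min_le_left _ _).trans_lt (by linarith)
  set z₀ := v₃ + lam • (m - v₃) with hz₀
  have hz₀T : z₀ ∈ Δ.tri := add_smul_mem_tri e₃.1 hmT hlam0.le hlam1
  have p₂ : 0 < Δ.phi s₃ v₂ * Δ.phi s₃ z₀ := by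
    have : Δ.phi s₃ v₂ * Δ.phi s₃ z₀ = lam * (1 - t) * (Δ.phi s₃ v₂ * Δ.phi s₃ v₂) := by
      rw [hz₀, phi_lineMap, e₃'.2, hm₃]; ring
    rw [this]
    exact mul_pos (mul_pos hlam0 (by linarith)) (mul_self_pos.mpr n₂)
  have p₄ : 0 < Δ.phi s₂ v₄ * Δ.phi s₂ z₀ := by
    have : Δ.phi s₂ v₄ * Δ.phi s₂ z₀ = lam * t * (Δ.phi s₂ v₄ * Δ.phi s₂ v₄) := by
      rw [hz₀, phi_lineMap, e₃.2, hm₂]; ring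
    rw [this]
    exact mul_pos (mul_pos hlam0 ht0) (mul_self_pos.mpr n₄)
  have h₀ : z₀ ∈ Δ.cell z₀ := by
    refine ⟨hz₀T, fun τ hτ => mul_self_pos.mpr ?_⟩
    by_cases hτ₂ : τ = s₂
    · rw [hτ₂]; exact right_ne_zero_of_mul p₄.ne'
    by_cases hτ₃ : τ = s₃
    · rw [hτ₃]; exact right_ne_zero_of_mul p₂.ne'
    exact right_ne_zero_of_mul (hlam τ ⟨hτ, by simp [hτ₂, hτ₃]⟩).ne'
  have hz₀b : z₀ ∈ b := by
    rw [mem_B_iff hb] at hv₃b ⊢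
    refine ⟨hz₀T, ?_⟩
    rw [hz₀, phi_lineMap, hv₃b.2]
    change _ + _ * aff _ m = 0
    rw [htm]; ring
  have k₃ : v₃ ∈ Δ.closedCell z₀ := by
    refine ⟨e₃.1, fun τ hτ => ?_⟩
    by_cases hτ₂ : τ = s₂
    · rw [hτ₂, e₃.2]; simp
    by_cases hτ₃ : τ = s₃
    · rw [hτ₃, e₃'.2]; simp
    exact (hlam τ ⟨hτ, by simp [hτ₂, hτ₃]⟩).le
  have kside : ∀ {s r : Set Pt} {v : Pt}, v ∈ Δ.tri → Δ.phi s v = 0 →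
      0 < Δ.phi r v * Δ.phi r z₀ → Δ.Free s v₃ v →
      (∀ τ ∈ Δ.Sbar, τ ≠ s → τ ≠ r → 0 < Δ.phi τ v₃ * Δ.phi τ z₀) → v ∈ Δ.closedCell z₀ := by
    intro s r v hvT hvs hvr hfree hτpos
    refine ⟨hvT, fun τ hτ => ?_⟩
    by_cases hτs : τ = s
    · rw [hτs, hvs]; simp
    by_cases hτr : τ = r
    · rw [hτr]; exact hvr.le
    have c1 := hτpos τ hτ hτs hτr
    have c2 := Sbar_cross_of_free e₃.1 hvT hfree hτ hτs
    have c3 : 0 ≤ (Δ.phi τ v₃ * Δ.phi τ v) * (Δ.phi τ z₀ * Δ.phi τ z₀) :=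
      mul_nonneg c2 (mul_self_nonneg _)
    by_contra! hlt
    nlinarith [mul_neg_of_pos_of_neg c1 hlt]
  have k₂ : v₂ ∈ Δ.closedCell z₀ := kside e₂.1 e₂.2 p₂ hf₂ fun τ hτ h h' =>
    hlam τ ⟨hτ, by simp [h, h']⟩
  have k₄ : v₄ ∈ Δ.closedCell z₀ := kside e₄.1 e₄.2 p₄ hf₄ fun τ hτ h h' =>
    hlam τ ⟨hτ, by simp [h, h']⟩
  obtain ⟨v₁, hv₁s₁, hv12, k₁, hf₁, r₁, hr₁, hrs₁, hv₁r⟩ :=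
    exists_next_closedCell h₀ h₂ h₁ h12.symm k₂ hv₂s₂ hv₂s₁
  obtain ⟨w₁, hw₁r, hw₁, kw₁, -⟩ := exists_next_closedCell h₀ h₁ hr₁ hrs₁.symm k₁ hv₁s₁ hv₁r
  obtain ⟨v₅, hv₅s₄, hv54, k₅, hf₅, r₅, hr₅, hrs₅, hv₅r⟩ :=
    exists_next_closedCell h₀ h₃ h₄ h34 k₄ hv₄s₃ hv₄s₄
  obtain ⟨w₅, hw₅r, hw₅, kw₅, -⟩ := exists_next_closedCell h₀ h₄ hr₅ hrs₅.symm k₅ hv₅s₄ hv₅r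
  by_cases h15 : v₁ = v₅
  · by_cases hx : Δ.phi b v₁ = 0
    · have hv₁b : v₁ ∈ b := (mem_B_iff hb _).mpr ⟨k₁.1, hx⟩
      rw [block_inter hb h₁ hqb hv₁b hqs₁ hv₁s₁, h15]
      exact hv₅s₄
    · exfalso
      have c1 := block_cross_of_free h₁ hv₂s₁ hv₁s₁ hf₁ hb
      have c2 := block_cross_of_free h₄ hv₄s₄ hv₅s₄ hf₅ hb
      rw [← h15] at c2
      nlinarith [mul_nonneg c1 c2, mul_self_pos.mpr hx,
        mul_neg_of_neg_of_pos hsep (mul_self_pos.mpr hx)]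
  have d13 : v₁ ≠ v₃ := by
    rintro rfl
    exact hv32 (Sbar_inter h₁ h₂ h12 hv₂s₁ hv₁s₁ hv₂s₂ hv₃s₂)
  have d35 : v₃ ≠ v₅ := by
    rintro rfl
    exact hv34 (Sbar_inter h₃ h₄ h34 hv₄s₃ hv₃s₃ hv₄s₄ hv₅s₄)
  have d24 : v₂ ≠ v₄ := by
    rintro rfl
    exact hv32 (Sbar_inter h₂ h₃ h23 hv₂s₂ hv₃s₂ hv₄s₃ hv₃s₃)
  have d14 : v₁ ≠ v₄ := by
    rintro rfl
    rcases concurrent h₃ h₄ h₁ hv₄s₃ hv₄s₄ hv₁s₁ h34 with h | h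
    · subst h
      exact hv32 (Sbar_inter h₂ h₁ h23 hv₂s₂ hv₃s₂ hv₂s₁ hv₃s₃)
    · exact h14 h
  have d25 : v₂ ≠ v₅ := by
    rintro rfl
    rcases concurrent h₁ h₂ h₄ hv₂s₁ hv₂s₂ hv₅s₄ h12 with h | h
    · exact h14 h.symm
    · subst h
      exact hv34 (Sbar_inter h₄ h₃ h23 hv₄s₄ hv₃s₂ hv₄s₃ hv₃s₃)
  have V₁ := isRegionVertex_closedCell h₀ h₁ hr₁ hrs₁.symm k₂ k₁ kw₁ hv12.symm hw₁.symm hv₂s₁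
    hv₁s₁ hv₁r hw₁r
  have V₂ := isRegionVertex_closedCell h₀ h₁ h₂ h12 k₁ k₂ k₃ hv12 hv32 hv₁s₁ hv₂s₁ hv₂s₂ hv₃s₂
  have V₃ := isRegionVertex_closedCell h₀ h₂ h₃ h23 k₂ k₃ k₄ hv32 hv34.symm hv₂s₂ hv₃s₂ hv₃s₃
    hv₄s₃
  have V₄ := isRegionVertex_closedCell h₀ h₃ h₄ h34 k₃ k₄ k₅ hv34.symm hv54.symm hv₃s₃ hv₄s₃
    hv₄s₄ hv₅s₄
  have V₅ := isRegionVertex_closedCell h₀ h₄ hr₅ hrs₅.symm k₄ k₅ kw₅ hv54.symm hw₅.symm hv₄s₄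
    hv₅s₄ hv₅r hw₅r
  obtain ⟨q', hq'b, hq'1, hq'4⟩ := hΔ _ (isMinRegion_closedCell h₀) v₁ v₂ v₃ v₄ v₅
    (by simp [hv12, d13, d14, h15, hv32, d24, d25, hv34.symm, d35, hv54.symm])
    ⟨hv12, V₁, V₂, (segment_subset_frontier h₀ h₁ k₁ k₂ hv₁s₁ hv₂s₁).trans inter_subset_right⟩
    ⟨hv32, V₂, V₃, (segment_subset_frontier h₀ h₂ k₂ k₃ hv₂s₂ hv₃s₂).trans inter_subset_right⟩
    ⟨hv34.symm, V₃, V₄,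
      (segment_subset_frontier h₀ h₃ k₃ k₄ hv₃s₃ hv₄s₃).trans inter_subset_right⟩
    ⟨hv54.symm, V₄, V₅,
      (segment_subset_frontier h₀ h₄ k₄ k₅ hv₄s₄ hv₅s₄).trans inter_subset_right⟩
    b hb hv₃b ⟨z₀, hz₀b, mem_interior_closedCell h₀⟩
    ⟨q, ((mem_B_iff hb q).mp hqb).1, (mem_affineSpan_pair_iff (Or.inl h₁) hv12 hv₁s₁ hv₂s₁
      ((mem_B_iff hb q).mp hqb).1).mpr hqs₁, hqb⟩
  have hq'T := ((mem_B_iff hb q').mp hq'b).1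
  rw [mem_affineSpan_pair_iff (Or.inl h₁) hv12 hv₁s₁ hv₂s₁ hq'T] at hq'1
  rw [mem_affineSpan_pair_iff (Or.inl h₄) hv54.symm hv₄s₄ hv₅s₄ hq'T] at hq'4
  rwa [block_inter hb h₁ hqb hq'b hqs₁ hq'1]

end TBA

/-- One if `x` and `y` have strictly opposite signs, zero otherwise. -/
def oppInd (x y : ℝ) : ℕ := if x * y < 0 then 1 else 0

theorem even_oppInd {a b c : ℝ} (ha : a = 0 → 0 ≤ b * c) (hb : b = 0 → 0 ≤ a * c)
    (hc : c = 0 → 0 ≤ a * b) : Even (oppInd a b + oppInd b c + oppInd a c) := by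
  unfold oppInd
  rcases lt_trichotomy a 0 with h1 | h1 | h1 <;> rcases lt_trichotomy b 0 with h2 | h2 | h2 <;>
    rcases lt_trichotomy c 0 with h3 | h3 | h3 <;>
    simp_all [mul_neg_iff, mul_nonneg_iff, le_of_lt, not_lt_of_gt, not_le_of_gt]

theorem odd_oppInd {a b c : ℝ} (hb : b = 0) (hac : a * c < 0) :
    Odd (oppInd a b + oppInd b c + oppInd a c) := by
  simp [oppInd, hb, hac]

namespace TBA

variable {Δ : TBA}

theorem phi_mul_neg {τ : Set Pt} {u v : Pt} {t : ℝ} (h0 : 0 < t) (h1 : t < 1)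
    (h : Δ.phi τ (u + t • (v - u)) = 0) (hu : Δ.phi τ u ≠ 0) : Δ.phi τ u * Δ.phi τ v < 0 :=
  aff_mul_neg_of_zero_between h0 h1 h hu

theorem add_smul_mem_Sbar {s : Set Pt} (hs : s ∈ Δ.Sbar) {u v : Pt} (hu : u ∈ s) (hv : v ∈ s)
    {t : ℝ} (h0 : 0 ≤ t) (h1 : t ≤ 1) : u + t • (v - u) ∈ s := by
  rw [mem_Sbar_iff hs] at hu hv ⊢
  refine ⟨add_smul_mem_tri hu.1 hv.1 h0 h1, ?_⟩
  rw [phi_lineMap, hu.2, hv.2]; ring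

theorem add_smul_ne {u v : Pt} (huv : u ≠ v) {t : ℝ} (h0 : t ≠ 0) : u + t • (v - u) ≠ u := by
  intro h
  exact h0 (add_smul_inj huv.symm (a := t) (b := 0) (by rw [h]; simp))

/-- A blocking segment passes through each crossing on an initial segment. -/
theorem exists_block_cross {s : Set Pt} (hs : s ∈ Δ.Sbar) {v w : Pt} (hv : v ∈ s) (hw : w ∈ s)
    {σ : Set Pt} (hσ : σ ∈ Δ.Sbar) (h : Δ.phi σ v * Δ.phi σ w < 0) :
    ∃ b ∈ Δ.B, Δ.phi b v * Δ.phi b w < 0 ∧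
      ∃ t : ℝ, 0 < t ∧ t < 1 ∧ v + t • (w - v) ∈ σ ∧ v + t • (w - v) ∈ b := by
  obtain ⟨t, h0, h1, ht⟩ := exists_aff_eq_zero h
  have hzs := add_smul_mem_Sbar hs hv hw h0.le h1.le
  have hv' := (mem_Sbar_iff hs v).mp hv
  have hw' := (mem_Sbar_iff hs w).mp hw
  have hvw : v ≠ w := by
    rintro rfl
    nlinarith [mul_self_nonneg (Δ.phi σ v)]
  have hzσ : v + t • (w - v) ∈ σ := by
    rw [mem_Sbar_iff hσ]
    exact ⟨((mem_Sbar_iff hs _).mp hzs).1, ht⟩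
  have hσs : σ ≠ s := by
    rintro rfl
    rw [hv'.2] at h; simp at h
  have hσS := mem_S_of_crosses hσ hv'.1 hw'.1 h
  obtain ⟨b, ⟨hb, hzb⟩, -⟩ := Δ.block_exists s hs σ hσ hσs.symm
    (fun h => not_mem_edges_of_mem_S (Or.inl hσS) h.2) _ hzs hzσ
  refine ⟨b, hb, phi_mul_neg h0 h1 ((mem_B_iff hb _).mp hzb).2 fun hvb => ?_,
    t, h0, h1, hzσ, hzb⟩
  exact add_smul_ne hvw h0.ne' (block_inter hb hs hzb ((mem_B_iff hb v).mpr ⟨hv'.1, hvb⟩) hzs hv)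

/-- An initial segment passes through each blocked point of an initial segment. -/
theorem exists_Sbar_cross {s : Set Pt} (hs : s ∈ Δ.Sbar) {v w : Pt} (hv : v ∈ s) (hw : w ∈ s)
    {b : Set Pt} (hb : b ∈ Δ.B) (h : Δ.phi b v * Δ.phi b w < 0) :
    ∃ σ ∈ Δ.Sbar, σ ≠ s ∧ Δ.phi σ v * Δ.phi σ w < 0 ∧
      ∃ t : ℝ, 0 < t ∧ t < 1 ∧ v + t • (w - v) ∈ σ ∧ v + t • (w - v) ∈ b := by
  obtain ⟨t, h0, h1, ht⟩ := exists_aff_eq_zero h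
  have hzs := add_smul_mem_Sbar hs hv hw h0.le h1.le
  have hv' := (mem_Sbar_iff hs v).mp hv
  have hvw : v ≠ w := by
    rintro rfl
    nlinarith [mul_self_nonneg (Δ.phi b v)]
  have hzb : v + t • (w - v) ∈ b := by
    rw [mem_B_iff hb]
    exact ⟨((mem_Sbar_iff hs _).mp hzs).1, ht⟩
  obtain ⟨σ, ⟨hσ, hσs, hzσ⟩, -⟩ := Δ.second_segment s hs b hb _ hzs hzb
  refine ⟨σ, hσ, hσs, phi_mul_neg h0 h1 ((mem_Sbar_iff hσ _).mp hzσ).2 fun hvσ => ?_,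
    t, h0, h1, hzσ, hzb⟩
  exact add_smul_ne hvw h0.ne' (Sbar_inter hσ hs hσs hzσ
    ((mem_Sbar_iff hσ v).mpr ⟨hv'.1, hvσ⟩) hzs hv)

/-- As many initial segments as blocking segments cross a piece of an initial segment. -/
theorem sum_oppInd_eq {s : Set Pt} (hs : s ∈ Δ.Sbar) {v w : Pt} (hv : v ∈ s) (hw : w ∈ s) :
    ∑ σ ∈ Δ.finite_Sbar.toFinset, oppInd (Δ.phi σ v) (Δ.phi σ w) =
      ∑ b ∈ Δ.finB.toFinset, oppInd (Δ.phi b v) (Δ.phi b w) := by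
  classical
  unfold oppInd
  rw [← Finset.card_filter, ← Finset.card_filter]
  have hv' := (mem_Sbar_iff hs v).mp hv
  apply le_antisymm
  · apply Finset.card_le_card_of_forall_subsingleton (fun σ b => ∃ z ∈ s, z ∈ σ ∧ z ∈ b)
    · intro σ hσ
      simp only [Finset.mem_filter, Set.Finite.mem_toFinset] at hσ ⊢
      obtain ⟨b, hb, hbc, t, h0, h1, h2, h3⟩ := exists_block_cross hs hv hw hσ.1 hσ.2
      exact ⟨b, ⟨hb, hbc⟩, _, add_smul_mem_Sbar hs hv hw h0.le h1.le, h2, h3⟩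
    · rintro b hb σ ⟨hσ, z, hzs, hzσ, hzb⟩ σ' ⟨hσ', z', hzs', hzσ', hzb'⟩
      simp only [Finset.mem_filter, Set.Finite.mem_toFinset] at hb hσ hσ'
      have hne : ∀ {τ}, Δ.phi τ v * Δ.phi τ w < 0 → τ ≠ s := by
        rintro τ h rfl
        rw [hv'.2] at h; simp at h
      obtain rfl := block_inter hb.1 hs hzb hzb' hzs hzs'
      rcases concurrent hs hσ.1 hσ'.1 hzs hzσ hzσ' (hne hσ.2).symm with h | h
      · exact absurd h (hne hσ'.2)
      · exact h.symm
  · apply Finset.card_le_card_of_forall_subsingleton (fun b σ => ∃ z ∈ s, z ∈ σ ∧ z ∈ b)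
    · intro b hb
      simp only [Finset.mem_filter, Set.Finite.mem_toFinset] at hb ⊢
      obtain ⟨σ, hσ, -, hσc, t, h0, h1, h2, h3⟩ := exists_Sbar_cross hs hv hw hb.1 hb.2
      exact ⟨σ, ⟨hσ, hσc⟩, _, add_smul_mem_Sbar hs hv hw h0.le h1.le, h2, h3⟩
    · rintro σ hσ b ⟨hb, z, hzs, hzσ, hzb⟩ b' ⟨hb', z', hzs', hzσ', hzb'⟩
      simp only [Finset.mem_filter, Set.Finite.mem_toFinset] at hb hσ hb'
      have hne : σ ≠ s := by
        rintro rfl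
        have h := hσ.2
        rw [hv'.2] at h; simp at h
      obtain rfl := Sbar_inter hs hσ.1 hne.symm hzs hzs' hzσ hzσ'
      exact Δ.block_unique s hs σ hσ.1 hne.symm z hzs hzσ b hb.1 b' hb'.1 hzb hzb'

/-- A triangle with corners `y`, `p`, `q` cut out by the initial segments `X ∋ y, p`,
`Y ∋ y, q` and `L ∋ p, q`, at most one of which is an edge. -/
structure IsTri (Δ : TBA) (X Y L : Set Pt) (y p q : Pt) : Prop where
  hX : X ∈ Δ.Sbar
  hY : Y ∈ Δ.Sbar
  hL : L ∈ Δ.Sbar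
  XY : X ≠ Y
  XL : X ≠ L
  YL : Y ≠ L
  yX : y ∈ X
  yY : y ∈ Y
  pX : p ∈ X
  pL : p ∈ L
  qY : q ∈ Y
  qL : q ∈ L
  pXY : X ∈ Δ.S ∨ Y ∈ Δ.S
  pXL : X ∈ Δ.S ∨ L ∈ Δ.S
  pYL : Y ∈ Δ.S ∨ L ∈ Δ.S

/-- The blocking segment through `p` separates `y` and `q`. -/
def BlockedAt (Δ : TBA) (p y q : Pt) : Prop :=
  ∃ b ∈ Δ.B, p ∈ b ∧ Δ.phi b y * Δ.phi b q < 0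

theorem BlockedAt.symm {p y q : Pt} (h : Δ.BlockedAt p y q) : Δ.BlockedAt p q y := by
  obtain ⟨b, hb, hpb, h⟩ := h
  exact ⟨b, hb, hpb, by rwa [mul_comm]⟩

/-- Twice the area of a triangle. -/
def area (y p q : Pt) : ℝ := |crs (p - y) (q - y)|

theorem area_swap (y p q : Pt) : area y q p = area y p q := by
  unfold area
  rw [← abs_neg]; congr 1; simp [crs]; ring

theorem area_rotate (y p q : Pt) : area p y q = area y p q := by
  unfold area
  rw [← abs_neg]; congr 1; simp [crs]; ring

namespace IsTri

variable {X Y L : Set Pt} {y p q : Pt}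

theorem swap (T : Δ.IsTri X Y L y p q) : Δ.IsTri Y X L y q p :=
  ⟨T.hY, T.hX, T.hL, T.XY.symm, T.YL, T.XL, T.yY, T.yX, T.qY, T.qL, T.pX, T.pL, T.pXY.symm,
    T.pYL, T.pXL⟩

theorem rotate (T : Δ.IsTri X Y L y p q) : Δ.IsTri X L Y p y q :=
  ⟨T.hX, T.hL, T.hY, T.XL, T.XY, T.YL.symm, T.pX, T.pL, T.yX, T.yY, T.qL, T.qY, T.pXL,
    T.pXY, T.pYL.symm⟩

theorem yT (T : Δ.IsTri X Y L y p q) : y ∈ Δ.tri := ((mem_Sbar_iff T.hX y).mp T.yX).1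

theorem pT (T : Δ.IsTri X Y L y p q) : p ∈ Δ.tri := ((mem_Sbar_iff T.hX p).mp T.pX).1

theorem qT (T : Δ.IsTri X Y L y p q) : q ∈ Δ.tri := ((mem_Sbar_iff T.hY q).mp T.qY).1

theorem y_not_mem (T : Δ.IsTri X Y L y p q) : y ∉ L := fun h => by
  rcases concurrent T.hX T.hY T.hL T.yX T.yY h T.XY with h | h
  · exact T.XL h.symm
  · exact T.YL h.symm

theorem ne_yp (T : Δ.IsTri X Y L y p q) : y ≠ p := by
  rintro rfl
  exact T.y_not_mem T.pL

theorem ne_yq (T : Δ.IsTri X Y L y p q) : y ≠ q := T.swap.ne_yp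

theorem ne_pq (T : Δ.IsTri X Y L y p q) : p ≠ q := T.rotate.ne_yq

theorem crs_ne (T : Δ.IsTri X Y L y p q) : crs (p - y) (q - y) ≠ 0 := by
  intro h
  obtain ⟨t, ht⟩ := exists_of_crs_eq_zero (sub_ne_zero.mpr T.ne_yp.symm) h
  have hq : q = y + t • (p - y) := by rw [← ht]; abel
  have hqX : q ∈ X := by
    rw [mem_Sbar_iff T.hX]
    refine ⟨T.qT, ?_⟩
    rw [hq, phi_lineMap, ((mem_Sbar_iff T.hX y).mp T.yX).2, ((mem_Sbar_iff T.hX p).mp T.pX).2]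
    ring
  exact T.swap.rotate.y_not_mem hqX

theorem area_pos (T : Δ.IsTri X Y L y p q) : 0 < area y p q := abs_pos.mpr T.crs_ne

/-- An initial segment through `y` is one of the sides at `y`. -/
theorem eq_of_phi_eq_zero (T : Δ.IsTri X Y L y p q) {σ : Set Pt} (hσ : σ ∈ Δ.Sbar)
    (h : Δ.phi σ y = 0) : σ = X ∨ σ = Y :=
  concurrent T.hX T.hY hσ T.yX T.yY ((mem_Sbar_iff hσ y).mpr ⟨T.yT, h⟩) T.XY

theorem phi_mul_eq_zero (T : Δ.IsTri X Y L y p q) {σ : Set Pt} (hσ : σ ∈ Δ.Sbar)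
    (h : Δ.phi σ y = 0) : Δ.phi σ p * Δ.phi σ q = 0 := by
  rcases T.eq_of_phi_eq_zero hσ h with rfl | rfl
  · rw [((mem_Sbar_iff hσ p).mp T.pX).2, zero_mul]
  · rw [((mem_Sbar_iff hσ q).mp T.qY).2, mul_zero]

/-- A blocked triangle is blocked at two corners. -/
theorem blocked_of_blocked (T : Δ.IsTri X Y L y p q) (h : Δ.BlockedAt p y q) :
    Δ.BlockedAt y p q ∨ Δ.BlockedAt q y p := by
  classical
  by_contra! hc
  obtain ⟨hy, hq⟩ := hc
  obtain ⟨b₀, hb₀, hpb₀, hsep⟩ := h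
  have hevS : Even (∑ σ ∈ Δ.finite_Sbar.toFinset, (oppInd (Δ.phi σ y) (Δ.phi σ p) +
      oppInd (Δ.phi σ p) (Δ.phi σ q) + oppInd (Δ.phi σ y) (Δ.phi σ q))) := by
    apply Finset.even_sum
    intro σ hσ
    rw [Set.Finite.mem_toFinset] at hσ
    exact even_oppInd (fun h => (T.phi_mul_eq_zero hσ h).ge)
      (fun h => (T.rotate.phi_mul_eq_zero hσ h).ge)
      (fun h => (T.swap.rotate.phi_mul_eq_zero hσ h).ge)
  simp only [Finset.sum_add_distrib] at hevS
  rw [sum_oppInd_eq T.hX T.yX T.pX, sum_oppInd_eq T.hL T.pL T.qL, sum_oppInd_eq T.hY T.yY T.qY,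
    ← Finset.sum_add_distrib, ← Finset.sum_add_distrib,
    ← Finset.add_sum_erase _ _ (Δ.finB.mem_toFinset.mpr hb₀)] at hevS
  have hrest : Even (∑ b ∈ Δ.finB.toFinset.erase b₀, (oppInd (Δ.phi b y) (Δ.phi b p) +
      oppInd (Δ.phi b p) (Δ.phi b q) + oppInd (Δ.phi b y) (Δ.phi b q))) := by
    apply Finset.even_sum
    intro b hb
    rw [Finset.mem_erase, Set.Finite.mem_toFinset] at hb
    refine even_oppInd (fun h => ?_) (fun h => ?_) (fun h => ?_)
    · by_contra! hlt
      exact hy ⟨b, hb.2, (mem_B_iff hb.2 y).mpr ⟨T.yT, h⟩, hlt⟩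
    · exact absurd (Δ.block_unique X T.hX L T.hL T.XL p T.pX T.pL b hb.2 b₀ hb₀
        ((mem_B_iff hb.2 p).mpr ⟨T.pT, h⟩) hpb₀) hb.1
    · by_contra! hlt
      exact hq ⟨b, hb.2, (mem_B_iff hb.2 q).mpr ⟨T.qT, h⟩, hlt⟩
  have hodd := odd_oppInd ((mem_B_iff hb₀ p).mp hpb₀).2 hsep
  exact Nat.not_even_iff_odd.mpr (hodd.add_even hrest) hevS

/-- An initial segment separating `p` from `y` and `q` cuts off a triangle at `p`. -/
theorem exists_cut (T : Δ.IsTri X Y L y p q) {σ : Set Pt} (hσ : σ ∈ Δ.Sbar)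
    (h₁ : Δ.phi σ p * Δ.phi σ y < 0) (h₂ : Δ.phi σ p * Δ.phi σ q < 0) :
    ∃ a c : ℝ, 0 < a ∧ a < 1 ∧ 0 < c ∧ c < 1 ∧
      Δ.IsTri X σ L (p + a • (y - p)) p (p + c • (q - p)) := by
  obtain ⟨a, a0, a1, ha⟩ := exists_aff_eq_zero h₁
  obtain ⟨c, c0, c1, hc⟩ := exists_aff_eq_zero h₂
  have hσS := mem_S_of_crosses hσ T.pT T.yT h₁
  have hp := left_ne_zero_of_mul h₁.ne
  have hu := add_smul_mem_Sbar T.hX T.pX T.yX a0.le a1.le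
  have hw := add_smul_mem_Sbar T.hL T.pL T.qL c0.le c1.le
  refine ⟨a, c, a0, a1, c0, c1, T.hX, hσ, T.hL, ?_, T.XL, ?_, hu, ?_, T.pX, T.pL, ?_, hw,
    Or.inr hσS, T.pXL, Or.inl hσS⟩
  · rintro rfl
    exact hp ((mem_Sbar_iff hσ p).mp T.pX).2
  · rintro rfl
    exact hp ((mem_Sbar_iff hσ p).mp T.pL).2
  · exact (mem_Sbar_iff hσ _).mpr ⟨((mem_Sbar_iff T.hX _).mp hu).1, ha⟩
  · exact (mem_Sbar_iff hσ _).mpr ⟨((mem_Sbar_iff T.hL _).mp hw).1, hc⟩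

end IsTri

end TBA

namespace TBA

variable {Δ : TBA}

theorem phi_scale {τ : Set Pt} {u v : Pt} {a : ℝ} (h : Δ.phi τ (u + a • (v - u)) = 0) (s : ℝ) :
    a * Δ.phi τ (u + s • (v - u)) = (a - s) * Δ.phi τ u := by
  rw [phi_lineMap] at h ⊢
  linear_combination s * h

/-- The initial segment `σ` cuts the sides `yp` and `yq` at the parameters `a` and `c`. -/
structure Chord (Δ : TBA) (y p q : Pt) (σ : Set Pt) (a c : ℝ) : Prop where
  mem : σ ∈ Δ.S
  a0 : 0 < a
  a1 : a < 1
  c0 : 0 < c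
  c1 : c < 1
  u : y + a • (p - y) ∈ σ
  w : y + c • (q - y) ∈ σ
  ne : Δ.phi σ y ≠ 0

namespace Chord

variable {y p q : Pt} {σ : Set Pt} {a c : ℝ}

theorem swap (h : Δ.Chord y p q σ a c) : Δ.Chord y q p σ c a :=
  ⟨h.mem, h.c0, h.c1, h.a0, h.a1, h.w, h.u, h.ne⟩

theorem memSbar (h : Δ.Chord y p q σ a c) : σ ∈ Δ.Sbar := Or.inl h.mem

theorem phi_u (h : Δ.Chord y p q σ a c) : Δ.phi σ (y + a • (p - y)) = 0 :=
  ((mem_Sbar_iff h.memSbar _).mp h.u).2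

theorem phi_w (h : Δ.Chord y p q σ a c) : Δ.phi σ (y + c • (q - y)) = 0 :=
  ((mem_Sbar_iff h.memSbar _).mp h.w).2

theorem neg_p (h : Δ.Chord y p q σ a c) : Δ.phi σ y * Δ.phi σ p < 0 :=
  phi_mul_neg h.a0 h.a1 h.phi_u h.ne

theorem neg_q (h : Δ.Chord y p q σ a c) : Δ.phi σ y * Δ.phi σ q < 0 := h.swap.neg_p

theorem c_eq (h : Δ.Chord y p q σ a c) : c = Δ.phi σ y / (Δ.phi σ y - Δ.phi σ q) := by
  have h1 := phi_scale h.phi_w 1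
  have h2 := h.neg_q
  have : Δ.phi σ y - Δ.phi σ q ≠ 0 := fun h0 => by
    have : Δ.phi σ q = Δ.phi σ y := by linarith
    rw [this] at h2
    nlinarith [mul_self_nonneg (Δ.phi σ y)]
  rw [eq_div_iff this]
  simp only [one_smul, add_sub_cancel] at h1
  linarith

theorem param_eq (C : Δ.Chord y p q σ a c) {t : ℝ} (h : y + t • (q - y) ∈ σ) : t = c := by
  have h1 := phi_scale C.phi_w t
  rw [((mem_Sbar_iff C.memSbar _).mp h).2, mul_zero] at h1
  have := (mul_eq_zero.mp h1.symm).resolve_right C.ne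
  linarith

theorem param_eq' (C : Δ.Chord y p q σ a c) {t : ℝ} (h : y + t • (p - y) ∈ σ) : t = a :=
  C.swap.param_eq h

end Chord

/-- A blocked triangle of minimal area. -/
structure MinTri (Δ : TBA) (X Y L : Set Pt) (y p q : Pt) : Prop where
  tri : Δ.IsTri X Y L y p q
  bp : Δ.BlockedAt p y q
  bq : Δ.BlockedAt q y p
  min : ∀ X' Y' L' y' p' q', Δ.IsTri X' Y' L' y' p' q' → Δ.BlockedAt p' y' q' →
    area y p q ≤ area y' p' q'

namespace MinTri

variable {X Y L : Set Pt} {y p q : Pt}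

theorem swap (M : Δ.MinTri X Y L y p q) : Δ.MinTri Y X L y q p :=
  ⟨M.tri.swap, M.bq, M.bp, fun X' Y' L' y' p' q' T h => by
    rw [area_swap]; exact M.min X' Y' L' y' p' q' T h⟩

theorem not_cut (M : Δ.MinTri X Y L y p q) {σ : Set Pt} (hσ : σ ∈ Δ.Sbar)
    (h₁ : Δ.phi σ p * Δ.phi σ y < 0) : 0 ≤ Δ.phi σ p * Δ.phi σ q := by
  by_contra! h₂
  obtain ⟨a, c, a0, a1, c0, c1, T⟩ := M.tri.exists_cut hσ h₁ h₂
  have hb : Δ.BlockedAt p (p + a • (y - p)) (p + c • (q - p)) := by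
    obtain ⟨b, hb, hpb, hs⟩ := M.bp
    refine ⟨b, hb, hpb, ?_⟩
    rw [phi_lineMap, phi_lineMap, ((mem_B_iff hb p).mp hpb).2]
    nlinarith [mul_neg_of_pos_of_neg (mul_pos a0 c0) hs]
  have h := M.min _ _ _ _ _ _ T hb
  have harea : area (p + a • (y - p)) p (p + c • (q - p)) = a * c * area y p q := by
    unfold area
    have : crs (p - (p + a • (y - p))) (p + c • (q - p) - (p + a • (y - p))) =
        a * c * crs (p - y) (q - y) := by simp [crs]; ring
    rw [this, abs_mul, abs_of_pos (mul_pos a0 c0)]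
  rw [harea] at h
  have h1 : a * c < 1 := by nlinarith
  nlinarith [M.tri.area_pos]

theorem exists_chord (M : Δ.MinTri X Y L y p q) {σ : Set Pt} (hσ : σ ∈ Δ.Sbar)
    (h : Δ.phi σ y * Δ.phi σ p < 0) : ∃ a c, Δ.Chord y p q σ a c := by
  have hy := left_ne_zero_of_mul h.ne
  have hp := right_ne_zero_of_mul h.ne
  have h1 := M.not_cut hσ (by rwa [mul_comm])
  have hq : Δ.phi σ q ≠ 0 := fun h0 => by
    rcases mul_eq_zero.mp (M.tri.swap.rotate.phi_mul_eq_zero hσ h0) with h | h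
    · exact hy h
    · exact hp h
  have h2 : 0 < Δ.phi σ p * Δ.phi σ q := h1.lt_of_ne' (mul_ne_zero hp hq)
  have h3 : Δ.phi σ y * Δ.phi σ q < 0 := by
    have := mul_neg_of_neg_of_pos h h2
    by_contra! h4
    nlinarith [mul_nonneg h4 (mul_self_nonneg (Δ.phi σ p))]
  obtain ⟨a, c, a0, a1, c0, c1, T⟩ := M.tri.rotate.exists_cut hσ h h3
  exact ⟨a, c, mem_S_of_crosses hσ M.tri.yT M.tri.pT h, a0, a1, c0, c1, T.yY, T.qY, hy⟩

theorem exists_chord' (M : Δ.MinTri X Y L y p q) {σ : Set Pt} (hσ : σ ∈ Δ.Sbar)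
    (h : Δ.phi σ y * Δ.phi σ q < 0) : ∃ a c, Δ.Chord y p q σ a c := by
  obtain ⟨a, c, h⟩ := M.swap.exists_chord hσ h
  exact ⟨c, a, h.swap⟩

theorem u_mem (M : Δ.MinTri X Y L y p q) {σ : Set Pt} {a c : ℝ} (C : Δ.Chord y p q σ a c) :
    y + a • (p - y) ∈ X := add_smul_mem_Sbar M.tri.hX M.tri.yX M.tri.pX C.a0.le C.a1.le

theorem w_mem (M : Δ.MinTri X Y L y p q) {σ : Set Pt} {a c : ℝ} (C : Δ.Chord y p q σ a c) :
    y + c • (q - y) ∈ Y := M.swap.u_mem C.swap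

theorem ne_X (M : Δ.MinTri X Y L y p q) {σ : Set Pt} {a c : ℝ} (C : Δ.Chord y p q σ a c) :
    σ ≠ X := by
  rintro rfl
  exact C.ne ((mem_Sbar_iff M.tri.hX y).mp M.tri.yX).2

theorem ne_Y (M : Δ.MinTri X Y L y p q) {σ : Set Pt} {a c : ℝ} (C : Δ.Chord y p q σ a c) :
    σ ≠ Y := M.swap.ne_X C.swap

theorem tri_chord (M : Δ.MinTri X Y L y p q) {σ : Set Pt} {a c : ℝ}
    (C : Δ.Chord y p q σ a c) :
    Δ.IsTri X Y σ y (y + a • (p - y)) (y + c • (q - y)) :=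
  ⟨M.tri.hX, M.tri.hY, C.memSbar, M.tri.XY, (M.ne_X C).symm, (M.ne_Y C).symm, M.tri.yX, M.tri.yY,
    M.u_mem C, C.u, M.w_mem C, C.w, M.tri.pXY, Or.inr C.mem, Or.inr C.mem⟩

theorem chord_not_blocked (M : Δ.MinTri X Y L y p q) {σ : Set Pt} {a c : ℝ}
    (C : Δ.Chord y p q σ a c) : ¬ Δ.BlockedAt (y + a • (p - y)) y (y + c • (q - y)) := by
  intro hb
  have h := M.min _ _ _ _ _ _ (M.tri_chord C) hb
  have harea : area y (y + a • (p - y)) (y + c • (q - y)) = a * c * area y p q := by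
    unfold area
    have : crs (y + a • (p - y) - y) (y + c • (q - y) - y) =
        a * c * crs (p - y) (q - y) := by simp [crs]; ring
    rw [this, abs_mul, abs_of_pos (mul_pos C.a0 C.c0)]
  rw [harea] at h
  have h1 : a * c < 1 := by nlinarith [C.a0, C.a1, C.c0, C.c1]
  nlinarith [M.tri.area_pos]

/-- The blocking segment at the end of a chord on `yp` separates `y` from the further part of
`yp`, but not from the other end of the chord. -/
theorem exists_block (M : Δ.MinTri X Y L y p q) {σ : Set Pt} {a c : ℝ}
    (C : Δ.Chord y p q σ a c) : ∃ b ∈ Δ.B, y + a • (p - y) ∈ b ∧ Δ.phi b y ≠ 0 ∧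
      0 < Δ.phi b y * Δ.phi b (y + c • (q - y)) := by
  have T := M.tri_chord C
  obtain ⟨b, ⟨hb, hub⟩, -⟩ := Δ.block_exists X T.hX σ T.hL T.XL
    (fun h => not_mem_edges_of_mem_S (Or.inl C.mem) h.2) _ T.pX T.pL
  have hy : Δ.phi b y ≠ 0 := fun h => T.ne_yp
    (block_inter hb T.hX ((mem_B_iff hb y).mpr ⟨T.yT, h⟩) hub T.yX T.pX)
  have hw : Δ.phi b (y + c • (q - y)) ≠ 0 := fun h => T.ne_pq
    (block_inter hb T.hL hub ((mem_B_iff hb _).mpr ⟨T.qT, h⟩) T.pL T.qL)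
  refine ⟨b, hb, hub, hy, ?_⟩
  by_contra! hle
  exact M.chord_not_blocked C ⟨b, hb, hub, hle.lt_of_ne (mul_ne_zero hy hw)⟩

/-- Chords do not cross inside the triangle. -/
theorem not_crossing (M : Δ.MinTri X Y L y p q) {σ₁ σ₂ : Set Pt} {a₁ c₁ a₂ c₂ : ℝ}
    (C₁ : Δ.Chord y p q σ₁ a₁ c₁) (C₂ : Δ.Chord y p q σ₂ a₂ c₂) (ha : a₁ < a₂) (hc : c₂ < c₁) :
    False := by
  have T₁ := M.tri_chord C₁
  have T₂ := M.tri_chord C₂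
  set u₁ := y + a₁ • (p - y) with hu₁
  set w₁ := y + c₁ • (q - y) with hw₁
  set u₂ := y + a₂ • (p - y) with hu₂
  have a20 := C₂.a0
  have c20 := C₂.c0
  have hyy := mul_self_pos.mpr C₂.ne
  have s₁ : 0 < Δ.phi σ₂ y * Δ.phi σ₂ u₁ := by
    have h := phi_scale C₂.phi_u a₁
    rw [← hu₁] at h
    have : a₂ * (Δ.phi σ₂ y * Δ.phi σ₂ u₁) = (a₂ - a₁) * (Δ.phi σ₂ y * Δ.phi σ₂ y) := by
      linear_combination Δ.phi σ₂ y * h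
    have h' : 0 < (a₂ - a₁) * (Δ.phi σ₂ y * Δ.phi σ₂ y) := mul_pos (by linarith) hyy
    exact pos_of_mul_pos_right (this ▸ h') a20.le
  have s₂ : Δ.phi σ₂ y * Δ.phi σ₂ w₁ < 0 := by
    have h := phi_scale C₂.phi_w c₁
    rw [← hw₁] at h
    have : c₂ * (Δ.phi σ₂ y * Δ.phi σ₂ w₁) = (c₂ - c₁) * (Δ.phi σ₂ y * Δ.phi σ₂ y) := by
      linear_combination Δ.phi σ₂ y * h
    have h' : (c₂ - c₁) * (Δ.phi σ₂ y * Δ.phi σ₂ y) < 0 := mul_neg_of_neg_of_pos (by linarith) hyy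
    by_contra! h0
    nlinarith [mul_nonneg c20.le h0]
  have s : Δ.phi σ₂ u₁ * Δ.phi σ₂ w₁ < 0 := by
    by_contra! h0
    nlinarith [mul_neg_of_pos_of_neg s₁ s₂, mul_nonneg hyy.le h0]
  obtain ⟨ν, n0, n1, hν⟩ := exists_aff_eq_zero s
  set z := u₁ + ν • (w₁ - u₁) with hz
  have hzσ₁ : z ∈ σ₁ := add_smul_mem_Sbar T₁.hL T₁.pL T₁.qL n0.le n1.le
  have hzσ₂ : z ∈ σ₂ := (mem_Sbar_iff T₂.hL z).mpr ⟨((mem_Sbar_iff T₁.hL z).mp hzσ₁).1, hν⟩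
  have hσ : σ₁ ≠ σ₂ := by
    rintro rfl
    rw [((mem_Sbar_iff T₁.hL _).mp T₁.pL).2, mul_zero] at s₁
    exact lt_irrefl _ s₁
  have T : Δ.IsTri X σ₂ σ₁ u₂ u₁ z :=
    ⟨T₁.hX, T₂.hL, T₁.hL, T₂.XL, T₁.XL, hσ.symm, T₂.pX, T₂.pL, T₁.pX, T₁.pL, hzσ₂, hzσ₁,
      Or.inr C₂.mem, Or.inr C₁.mem, Or.inr C₁.mem⟩
  obtain ⟨b, hb, hub, hby, hbw⟩ := M.exists_block C₁
  have hbu := ((mem_B_iff hb _).mp hub).2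
  have hblk : Δ.BlockedAt u₁ u₂ z := by
    refine ⟨b, hb, hub, ?_⟩
    have h := phi_scale hbu a₂
    rw [← hu₂] at h
    have e1 : a₁ * (Δ.phi b y * Δ.phi b u₂) = (a₁ - a₂) * (Δ.phi b y * Δ.phi b y) := by
      linear_combination Δ.phi b y * h
    have e2 : Δ.phi b z = ν * Δ.phi b w₁ := by
      rw [hz, phi_lineMap, hu₁, hbu]; ring
    have h' : (a₁ - a₂) * (Δ.phi b y * Δ.phi b y) < 0 :=
      mul_neg_of_neg_of_pos (by linarith) (mul_self_pos.mpr hby)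
    have e3 : Δ.phi b y * Δ.phi b u₂ < 0 := by
      by_contra! h0
      nlinarith [mul_nonneg C₁.a0.le h0]
    rw [e2]
    have e4 := mul_neg_of_neg_of_pos e3 (mul_pos n0 hbw)
    by_contra! h0
    nlinarith [mul_nonneg h0 (mul_self_nonneg (Δ.phi b y))]
  have h := M.min _ _ _ _ _ _ T hblk
  have harea : area u₂ u₁ z = (a₂ - a₁) * (ν * c₁) * area y p q := by
    unfold area
    have : crs (u₁ - u₂) (z - u₂) = -((a₂ - a₁) * (ν * c₁) * crs (p - y) (q - y)) := by
      rw [hz, hu₁, hu₂, hw₁]; simp [crs]; ring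
    rw [this, abs_neg, abs_mul, abs_of_pos (mul_pos (by linarith) (mul_pos n0 C₁.c0))]
  rw [harea] at h
  have h1 : (a₂ - a₁) * (ν * c₁) < 1 := by
    have := C₁.a0
    have := C₂.a1
    have h2 : ν * c₁ < 1 := by nlinarith [C₁.c1, C₁.c0]
    nlinarith [mul_pos n0 C₁.c0]
  nlinarith [M.tri.area_pos]

theorem ne_params (M : Δ.MinTri X Y L y p q) {σ₁ σ₂ : Set Pt} {a₁ c₁ a₂ c₂ : ℝ}
    (C₁ : Δ.Chord y p q σ₁ a₁ c₁) (C₂ : Δ.Chord y p q σ₂ a₂ c₂) (h : σ₁ ≠ σ₂) : a₁ ≠ a₂ := by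
  rintro rfl
  rcases concurrent M.tri.hX C₁.memSbar C₂.memSbar (M.u_mem C₁) C₁.u C₂.u (M.ne_X C₁).symm
    with h' | h'
  · exact M.ne_X C₂ h'
  · exact h h'.symm

theorem lt_of_lt (M : Δ.MinTri X Y L y p q) {σ₁ σ₂ : Set Pt} {a₁ c₁ a₂ c₂ : ℝ}
    (C₁ : Δ.Chord y p q σ₁ a₁ c₁) (C₂ : Δ.Chord y p q σ₂ a₂ c₂) (h : σ₁ ≠ σ₂) (hc : c₁ < c₂) :
    a₁ < a₂ := by
  by_contra! hle
  exact M.not_crossing C₂ C₁ (hle.lt_of_ne (M.ne_params C₁ C₂ h).symm) hc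

/-- A minimal blocked triangle has only one chord. -/
theorem chord_unique (M : Δ.MinTri X Y L y p q) {σ₁ σ₂ : Set Pt} {a₁ c₁ a₂ c₂ : ℝ}
    (C₁ : Δ.Chord y p q σ₁ a₁ c₁) (C₂ : Δ.Chord y p q σ₂ a₂ c₂) : σ₁ = σ₂ := by
  by_contra hne
  set f : Set Pt → ℝ := fun σ => Δ.phi σ y / (Δ.phi σ y - Δ.phi σ q) with hf
  set P : Set (Set Pt) := {σ | ∃ a c, Δ.Chord y p q σ a c} with hP
  have hfin : P.Finite := Δ.finite_Sbar.subset (fun σ ⟨_, _, C⟩ => C.memSbar)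
  obtain ⟨s₁, ⟨a, c, D₁⟩, hmin₁⟩ := Set.exists_min_image P f hfin ⟨σ₁, _, _, C₁⟩
  have hne2 : (P \ {s₁}).Nonempty := by
    by_cases h : σ₁ = s₁
    · exact ⟨σ₂, ⟨_, _, C₂⟩, fun h' => hne (h.trans h'.symm)⟩
    · exact ⟨σ₁, ⟨_, _, C₁⟩, h⟩
  obtain ⟨s₂, ⟨⟨a', c', D₂⟩, hs₂⟩, hmin₂⟩ :=
    Set.exists_min_image (P \ {s₁}) f (hfin.subset sdiff_subset) hne2
  have hs : s₁ ≠ s₂ := fun h => hs₂ h.symm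
  have hcc : c < c' := by
    refine lt_of_le_of_ne ?_ (M.swap.ne_params D₁.swap D₂.swap hs)
    rw [D₁.c_eq, D₂.c_eq]
    exact hmin₁ s₂ ⟨_, _, D₂⟩
  have haa := M.lt_of_lt D₁ D₂ hs hcc
  have T := M.tri_chord D₂
  obtain ⟨b, hb, hub, hby, hbw⟩ := M.exists_block D₁
  have hbu₂ : Δ.phi b y * Δ.phi b (y + a' • (p - y)) < 0 := by
    have h := phi_scale ((mem_B_iff hb _).mp hub).2 a'
    have e1 : a * (Δ.phi b y * Δ.phi b (y + a' • (p - y))) =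
        (a - a') * (Δ.phi b y * Δ.phi b y) := by
      linear_combination Δ.phi b y * h
    have h' : (a - a') * (Δ.phi b y * Δ.phi b y) < 0 :=
      mul_neg_of_neg_of_pos (by linarith) (mul_self_pos.mpr hby)
    by_contra! h0
    nlinarith [mul_nonneg D₁.a0.le h0]
  rcases lt_trichotomy (Δ.phi b y * Δ.phi b (y + c' • (q - y))) 0 with hlt | heq | hgt
  · obtain ⟨σ, hσ, hσY, hσc, t, t0, t1, hzσ, hzb⟩ := exists_Sbar_cross T.hY T.yY T.qY hb hlt
    have hz : y + t • (y + c' • (q - y) - y) = y + (t * c') • (q - y) := by module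
    rw [hz] at hzσ hzb
    have c'0 := D₂.c0
    have c'1 := D₂.c1
    have hneg := phi_mul_neg (mul_pos t0 c'0) (by nlinarith) ((mem_Sbar_iff hσ _).mp hzσ).2
      (left_ne_zero_of_mul hσc.ne)
    obtain ⟨aσ, cσ, Cσ⟩ := M.exists_chord' hσ hneg
    have hcσ := Cσ.param_eq hzσ
    have hσ₁ : σ = s₁ := by
      by_contra h
      have := hmin₂ σ ⟨⟨_, _, Cσ⟩, h⟩
      simp only [hf] at this
      rw [← D₂.c_eq, ← Cσ.c_eq, ← hcσ] at this
      nlinarith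
    subst hσ₁
    rw [D₁.param_eq hzσ] at hzb
    rw [((mem_B_iff hb _).mp hzb).2, mul_zero] at hbw
    exact lt_irrefl _ hbw
  · have hwb := (mem_B_iff hb _).mpr ⟨T.qT, (mul_eq_zero.mp heq).resolve_left hby⟩
    exact M.swap.chord_not_blocked D₂.swap ⟨b, hb, hwb, hbu₂⟩
  · have hlt : Δ.phi b (y + a' • (p - y)) * Δ.phi b (y + c' • (q - y)) < 0 := by
      by_contra! h0
      nlinarith [mul_neg_of_neg_of_pos hbu₂ hgt, mul_nonneg h0 (mul_self_nonneg (Δ.phi b y))]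
    obtain ⟨σ, hσ, hσs, hσc, -⟩ := exists_Sbar_cross T.hL T.pL T.qL hb hlt
    have hσy : Δ.phi σ y ≠ 0 := fun h0 => by
      rw [T.phi_mul_eq_zero hσ h0] at hσc
      exact lt_irrefl _ hσc
    have scale : ∀ {v : Pt} {τ : ℝ}, 0 < τ → τ < 1 →
        Δ.phi σ y * Δ.phi σ (y + τ • (v - y)) < 0 → ∃ r, 0 < r ∧ r < τ ∧
          Δ.phi σ (y + r • (v - y)) = 0 ∧ Δ.phi σ y * Δ.phi σ v < 0 := by
      intro v τ h0 h1 h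
      obtain ⟨t, t0, t1, ht⟩ := exists_aff_eq_zero h
      have hz : y + t • (y + τ • (v - y) - y) = y + (t * τ) • (v - y) := by module
      rw [hz] at ht
      exact ⟨t * τ, mul_pos t0 h0, by nlinarith, ht,
        phi_mul_neg (mul_pos t0 h0) (by nlinarith) ht hσy⟩
    have hsides : Δ.phi σ y * Δ.phi σ (y + a' • (p - y)) < 0 ∧
        0 < Δ.phi σ y * Δ.phi σ (y + c' • (q - y)) ∨
        Δ.phi σ y * Δ.phi σ (y + c' • (q - y)) < 0 ∧
        0 < Δ.phi σ y * Δ.phi σ (y + a' • (p - y)) := by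
      have h1 : Δ.phi σ y * Δ.phi σ (y + a' • (p - y)) ≠ 0 :=
        mul_ne_zero hσy (left_ne_zero_of_mul hσc.ne)
      have h2 : Δ.phi σ y * Δ.phi σ (y + c' • (q - y)) ≠ 0 :=
        mul_ne_zero hσy (right_ne_zero_of_mul hσc.ne)
      have h3 := mul_neg_of_neg_of_pos hσc (mul_self_pos.mpr hσy)
      rcases h1.lt_or_gt with h1 | h1 <;> rcases h2.lt_or_gt with h2 | h2
      · nlinarith [mul_pos_of_neg_of_neg h1 h2]
      · exact Or.inl ⟨h1, h2⟩
      · exact Or.inr ⟨h2, h1⟩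
      · nlinarith [mul_pos h1 h2]
    rcases hsides with ⟨h1, h2⟩ | ⟨h1, h2⟩
    · obtain ⟨r, r0, r1, hr, hneg⟩ := scale D₂.a0 D₂.a1 h1
      obtain ⟨aσ, cσ, Cσ⟩ := M.exists_chord hσ hneg
      have hra : r = aσ := Cσ.param_eq' ((mem_Sbar_iff hσ _).mpr
        ⟨add_smul_mem_tri T.yT M.tri.pT r0.le (r1.trans D₂.a1).le, hr⟩)
      refine M.not_crossing Cσ D₂ (hra ▸ r1) ?_
      have e : cσ * (Δ.phi σ y * Δ.phi σ (y + c' • (q - y))) =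
          (cσ - c') * (Δ.phi σ y * Δ.phi σ y) := by
        linear_combination Δ.phi σ y * phi_scale Cσ.phi_w c'
      by_contra! hle
      nlinarith [mul_pos Cσ.c0 h2, mul_nonneg (sub_nonneg.mpr hle) (mul_self_nonneg (Δ.phi σ y))]
    · obtain ⟨r, r0, r1, hr, hneg⟩ := scale D₂.c0 D₂.c1 h1
      obtain ⟨aσ, cσ, Cσ⟩ := M.exists_chord' hσ hneg
      have hra : r = cσ := Cσ.param_eq ((mem_Sbar_iff hσ _).mpr
        ⟨add_smul_mem_tri T.yT M.tri.qT r0.le (r1.trans D₂.c1).le, hr⟩)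
      refine M.not_crossing D₂ Cσ ?_ (hra ▸ r1)
      have e : aσ * (Δ.phi σ y * Δ.phi σ (y + a' • (p - y))) =
          (aσ - a') * (Δ.phi σ y * Δ.phi σ y) := by
        linear_combination Δ.phi σ y * phi_scale Cσ.phi_u a'
      by_contra! hle
      nlinarith [mul_pos Cσ.a0 h2, mul_nonneg (sub_nonneg.mpr hle) (mul_self_nonneg (Δ.phi σ y))]

/-- The blocking segment through `p` passes through the end of a chord on `yq`. -/
theorem exists_chord_block (M : Δ.MinTri X Y L y p q) : ∃ σ a c, Δ.Chord y p q σ a c ∧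
    ∃ b ∈ Δ.B, p ∈ b ∧ y + c • (q - y) ∈ b := by
  obtain ⟨b, hb, hpb, hs⟩ := M.bp
  obtain ⟨σ, hσ, hσY, hσc, t, t0, t1, hzσ, hzb⟩ :=
    exists_Sbar_cross M.tri.hY M.tri.yY M.tri.qY hb hs
  obtain ⟨a, c, C⟩ := M.exists_chord' hσ hσc
  obtain rfl := C.param_eq hzσ
  exact ⟨σ, a, t, C, b, hb, hpb, hzb⟩

/-- The chord of a minimal blocked triangle and the blocking segments through its ends. -/
theorem exists_unique_chord (M : Δ.MinTri X Y L y p q) : ∃ t a c, Δ.Chord y p q t a c ∧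
    (∃ b ∈ Δ.B, p ∈ b ∧ y + c • (q - y) ∈ b) ∧ (∃ b ∈ Δ.B, q ∈ b ∧ y + a • (p - y) ∈ b) := by
  obtain ⟨t, a, c, C, h⟩ := M.exists_chord_block
  obtain ⟨t', c', a', C', h'⟩ := M.swap.exists_chord_block
  obtain rfl := M.chord_unique C C'.swap
  obtain rfl := C.param_eq' C'.w
  exact ⟨t, a', c, C, h, h'⟩

end MinTri

end TBA

namespace TBA

variable {Δ : TBA}

theorem exists_next_beyond {s t : Set Pt} (hs : s ∈ Δ.S) (ht : t ∈ Δ.S) (hst : s ≠ t) {u z : Pt}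
    (hus : u ∈ s) (hut : u ∈ t) (hz : z ∈ t) (huz : z ≠ u) : ∃ μ : ℝ, 0 < μ ∧
      u + (-μ) • (z - u) ∈ t ∧ (∃ s' ∈ Δ.Sbar, s' ≠ t ∧ u + (-μ) • (z - u) ∈ s') ∧
      Δ.Free t u (u + (-μ) • (z - u)) := by
  have htS : t ∈ Δ.Sbar := Or.inl ht
  have hz' := (mem_Sbar_iff htS z).mp hz
  obtain ⟨ε, hε, hm⟩ := exists_prolong (u := u) hz'.1
    fun i => Or.inl (bary_pos_of_mem_S hs ht hst hus hut i)
  have hmt : u + (-ε) • (z - u) ∈ t := by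
    rw [mem_Sbar_iff htS]
    refine ⟨hm, ?_⟩
    rw [phi_lineMap, ((mem_Sbar_iff htS u).mp hut).2, hz'.2]; ring
  obtain ⟨μ, hμ, h⟩ := exists_next_free htS hut hmt (add_smul_ne huz.symm (by linarith))
  have e : u + μ • (u + (-ε) • (z - u) - u) = u + (-(μ * ε)) • (z - u) := by module
  rw [e] at h
  exact ⟨μ * ε, mul_pos hμ hε, h⟩

namespace MinTri

variable {X Y L : Set Pt} {y p q : Pt}

/-- Beyond its end on `yq`, the only chord of a minimal blocked triangle next meets `L`. -/
theorem exists_next_mem (M : Δ.MinTri X Y L y p q) (hΔ : Δ.Strong) (hY : Y ∈ Δ.S) {t : Set Pt}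
    {a c : ℝ} (C : Δ.Chord y p q t a c) {b : Set Pt} (hb : b ∈ Δ.B) (hpb : p ∈ b)
    (hwb : y + c • (q - y) ∈ b) : ∃ μ : ℝ, 0 < μ ∧
      y + c • (q - y) + (-μ) • (y + a • (p - y) - (y + c • (q - y))) ∈ t ∩ L ∧
      Δ.Free t (y + c • (q - y))
        (y + c • (q - y) + (-μ) • (y + a • (p - y) - (y + c • (q - y)))) := by
  have T := M.tri_chord C
  have hbu : Δ.phi b (y + a • (p - y)) = (1 - a) * Δ.phi b y := by
    rw [phi_lineMap, ((mem_B_iff hb p).mp hpb).2]; ring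
  have hby : Δ.phi b y ≠ 0 := fun h => M.tri.ne_yp
    (block_inter hb M.tri.hX ((mem_B_iff hb y).mpr ⟨T.yT, h⟩) hpb M.tri.yX M.tri.pX)
  have hfree : Δ.Free Y (y + c • (q - y)) y := by
    refine Free.symm fun ν h0 h1 σ hσ hσY hm => ?_
    have e : y + ν • (y + c • (q - y) - y) = y + (ν * c) • (q - y) := by module
    rw [e] at hm
    have hc0 := C.c0
    have hν : ν * c < c := by nlinarith
    have hσy : Δ.phi σ y ≠ 0 := fun h => add_smul_ne M.tri.ne_yq (mul_pos h0 hc0).ne'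
      (Sbar_inter hσ M.tri.hY hσY hm ((mem_Sbar_iff hσ y).mpr ⟨T.yT, h⟩)
        (add_smul_mem_Sbar M.tri.hY M.tri.yY M.tri.qY (mul_pos h0 hc0).le (by linarith [C.c1]))
        M.tri.yY)
    obtain ⟨a', c', C'⟩ := M.exists_chord' hσ
      (phi_mul_neg (mul_pos h0 hc0) (by linarith [C.c1]) ((mem_Sbar_iff hσ _).mp hm).2 hσy)
    obtain rfl := M.chord_unique C C'
    exact hν.ne (C.param_eq hm)
  generalize y + a • (p - y) = u at *
  generalize y + c • (q - y) = w at *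
  obtain ⟨μ, hμ, hvt, ⟨s, hs, hst, hvs⟩, hf⟩ := exists_next_beyond hY C.mem (M.ne_Y C).symm
    T.qY T.qL T.pL T.ne_pq
  refine ⟨μ, hμ, ⟨hvt, ?_⟩, hf⟩
  have hvw := add_smul_ne T.ne_pq.symm (neg_ne_zero.mpr hμ.ne')
  have hps := hΔ.mem_of_mem T.hX T.hY T.hL hs T.XY T.YL hst.symm T.yX T.yY T.qY T.qL hvt hvs
    T.ne_yq hvw hfree hf hb hwb (by
      rw [phi_lineMap, ((mem_B_iff hb w).mp hwb).2, hbu]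
      have := mul_pos (mul_pos hμ (sub_pos.mpr C.a1)) (mul_self_pos.mpr hby)
      linarith) hpb M.tri.pX
  rcases concurrent M.tri.hX M.tri.hL hs M.tri.pX M.tri.pL hps M.tri.XL with rfl | rfl
  · have h1 := Sbar_inter T.hL T.hX T.XL.symm hvt T.pL hvs T.pX
    have := add_smul_inj T.ne_pq (a := -μ) (b := 1) (by rw [h1]; simp)
    linarith
  · exact hvs

theorem false_of_mem (M : Δ.MinTri X Y L y p q) (hΔ : Δ.Strong) (hY : Y ∈ Δ.S) (hL : L ∈ Δ.S) :
    False := by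
  obtain ⟨t, a, c, C, ⟨b, hb, hpb, hwb⟩, b', hb', hqb', hub'⟩ := M.exists_unique_chord
  obtain ⟨μ, hμ, ⟨hvt, hvL⟩, hf⟩ := M.exists_next_mem hΔ hY C hb hpb hwb
  have T := M.tri_chord C
  have hb'w : Δ.phi b' (y + c • (q - y)) = (1 - c) * Δ.phi b' y := by
    rw [phi_lineMap, ((mem_B_iff hb' q).mp hqb').2]; ring
  have hby : Δ.phi b' y ≠ 0 := fun h => M.tri.ne_yq
    (block_inter hb' M.tri.hY ((mem_B_iff hb' y).mpr ⟨T.yT, h⟩) hqb' M.tri.yY M.tri.qY)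
  have huniq : ∀ σ ∈ Δ.Sbar, Δ.phi σ (y + c • (q - y)) * Δ.phi σ q < 0 → False := by
    intro σ hσ h
    obtain ⟨ν, n0, n1, hν⟩ := exists_aff_eq_zero h
    have e : y + c • (q - y) + ν • (q - (y + c • (q - y))) =
      y + (c + ν * (1 - c)) • (q - y) := by module
    have hc0 := C.c0
    have hc1 := C.c1
    have h1 : 0 < ν * (1 - c) := mul_pos n0 (by linarith)
    have h2 : c + ν * (1 - c) < 1 := by nlinarith
    rw [e] at hν
    have hm := (mem_Sbar_iff hσ _).mpr
      ⟨add_smul_mem_tri T.yT M.tri.qT (by linarith) h2.le, hν⟩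
    have hσY : σ ≠ Y := by
      rintro rfl
      rw [((mem_Sbar_iff hσ q).mp M.tri.qY).2, mul_zero] at h
      exact lt_irrefl _ h
    have hσy : Δ.phi σ y ≠ 0 := fun h0 => add_smul_ne M.tri.ne_yq (by linarith)
      (Sbar_inter hσ M.tri.hY hσY hm ((mem_Sbar_iff hσ y).mpr ⟨T.yT, h0⟩)
        (add_smul_mem_Sbar M.tri.hY M.tri.yY M.tri.qY (by linarith) h2.le) M.tri.yY)
    obtain ⟨a', c', C'⟩ := M.exists_chord' hσ (phi_mul_neg (by linarith) h2 hν hσy)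
    obtain rfl := M.chord_unique C C'
    have := C.param_eq hm
    linarith
  have hwq : y + c • (q - y) ≠ q := fun h => by
    have := add_smul_inj M.tri.ne_yq.symm (a := c) (b := 1) (by rw [h]; simp)
    linarith [C.c1]
  have hyq : y ≠ q := M.tri.ne_yq
  have hc1 := C.c1
  generalize y + a • (p - y) = u at *
  generalize y + c • (q - y) = w at *
  have hLt : t ≠ L := by
    rintro rfl
    exact hwq (Sbar_inter T.hL T.hY T.YL.symm T.qL M.tri.qL T.qY M.tri.qY)
  have hvq : w + (-μ) • (u - w) ≠ q := fun h =>
    hwq (Sbar_inter T.hL T.hY T.YL.symm T.qL (h ▸ hvt) T.qY M.tri.qY)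
  obtain ⟨μ', hμ', hvY, ⟨s, hs, hsY, hvs⟩, hf'⟩ := exists_next_beyond hL hY M.tri.YL.symm
    M.tri.qL M.tri.qY M.tri.yY hyq
  have hfL : Δ.Free L q (w + (-μ) • (u - w)) := by
    intro ν n0 n1 σ hσ hσL hm
    have hqv : q ≠ w + (-μ) • (u - w) := hvq.symm
    have hσq : Δ.phi σ q ≠ 0 := fun h0 => add_smul_ne hqv n0.ne'
      (Sbar_inter hσ M.tri.hL hσL hm ((mem_Sbar_iff hσ q).mpr ⟨M.tri.qT, h0⟩)
        (add_smul_mem_Sbar M.tri.hL M.tri.qL hvL n0.le n1.le) M.tri.qL)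
    have hneg := phi_mul_neg n0 n1 ((mem_Sbar_iff hσ _).mp hm).2 hσq
    have hσt : σ ≠ t := by
      rintro rfl
      rw [((mem_Sbar_iff hσ _).mp hvt).2, mul_zero] at hneg
      exact lt_irrefl _ hneg
    have hnn := Sbar_cross_of_free T.qT ((mem_Sbar_iff T.hL _).mp hvt).1 hf hσ hσt
    by_cases hσw : Δ.phi σ w = 0
    · rcases concurrent T.hY T.hL hσ T.qY T.qL ((mem_Sbar_iff hσ w).mpr ⟨T.qT, hσw⟩) T.YL
        with rfl | rfl
      · exact hσq ((mem_Sbar_iff hσ q).mp M.tri.qY).2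
      · exact hσt rfl
    · refine huniq σ hσ ?_
      have hpos := hnn.lt_of_ne' (mul_ne_zero hσw (right_ne_zero_of_mul hneg.ne))
      by_contra! h0
      have h1 := mul_neg_of_pos_of_neg hpos hneg
      nlinarith [mul_nonneg h0 (mul_self_nonneg (Δ.phi σ (w + (-μ) • (u - w))))]
  have hus := hΔ.mem_of_mem T.hL M.tri.hL M.tri.hY hs hLt M.tri.YL.symm hsY.symm hvt hvL
    M.tri.qL M.tri.qY hvY hvs hvq (add_smul_ne hyq.symm (neg_ne_zero.mpr hμ'.ne')) hfL hf'
    hb' hqb' (by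
      rw [phi_lineMap, phi_lineMap, ((mem_B_iff hb' q).mp hqb').2,
        ((mem_B_iff hb' u).mp hub').2, hb'w]
      have := mul_pos (mul_pos (mul_pos (by linarith : (0 : ℝ) < 1 + μ) (sub_pos.mpr hc1)) hμ')
        (mul_self_pos.mpr hby)
      linarith) hub' T.pL
  rcases concurrent T.hX T.hL hs T.pX T.pL hus T.XL with rfl | rfl
  · have h1 := Sbar_inter T.hY T.hX T.XY.symm hvY T.yY hvs T.yX
    have := add_smul_inj hyq (a := -μ') (b := 1) (by rw [h1]; simp)
    linarith
  · have h1 := Sbar_inter T.hY T.hL T.YL hvY T.qY hvs T.qL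
    have h2 := C.neg_q
    have h3 : Δ.phi s (q + (-μ') • (y - q)) = 0 := ((mem_Sbar_iff hs _).mp hvs).2
    rw [phi_lineMap] at h3
    have h4 : (1 + μ') * (Δ.phi s y * Δ.phi s q) = μ' * (Δ.phi s y * Δ.phi s y) := by
      linear_combination Δ.phi s y * h3
    have h5 := mul_neg_of_pos_of_neg (by linarith : (0 : ℝ) < 1 + μ') h2
    have := mul_nonneg hμ'.le (mul_self_nonneg (Δ.phi s y))
    linarith

theorem false (M : Δ.MinTri X Y L y p q) (hΔ : Δ.Strong) : False := by
  by_cases hL : L ∈ Δ.S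
  · rcases M.tri.pXY with hX | hY
    · exact M.swap.false_of_mem hΔ hX hL
    · exact M.false_of_mem hΔ hY hL
  · have hX := M.tri.pXL.resolve_right hL
    have hY := M.tri.pYL.resolve_right hL
    obtain ⟨t, a, c, C, ⟨b, hb, hpb, hwb⟩, b', hb', hqb', hub'⟩ := M.exists_unique_chord
    obtain ⟨μ, hμ, ⟨hvt, hvL⟩, -⟩ := M.exists_next_mem hΔ hY C hb hpb hwb
    obtain ⟨μ', hμ', ⟨hvt', hvL'⟩, -⟩ := M.swap.exists_next_mem hΔ hX C.swap hb' hqb' hub'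
    have T := M.tri_chord C
    have htL : t ≠ L := fun h => hL (h ▸ C.mem)
    have h := Sbar_inter C.memSbar M.tri.hL htL hvt hvt' hvL hvL'
    generalize y + a • (p - y) = u at *
    generalize y + c • (q - y) = w at *
    have := add_smul_inj T.ne_pq (a := -μ) (b := 1 + μ') (by rw [h]; module)
    linarith

end MinTri

theorem finite_vertices (Δ : TBA) : {v | Δ.IsVertex v}.Finite := by
  have h : (⋃ s ∈ Δ.Sbar, ⋃ s' ∈ Δ.Sbar \ {s}, s ∩ s').Finite := by
    refine Δ.finite_Sbar.biUnion fun s hs =>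
      (Δ.finite_Sbar.subset sdiff_subset).biUnion fun s' hs' => Set.Subsingleton.finite ?_
    intro x hx z hz
    exact Sbar_inter hs hs'.1 (fun h => hs'.2 h.symm) hx.1 hz.1 hx.2 hz.2
  refine h.subset ?_
  rintro v ⟨s, hs, s', hs', hne, h1, h2⟩
  simp only [mem_iUnion]
  exact ⟨s, hs, s', ⟨hs', fun h => hne h.symm⟩, h1, h2⟩

/-- The corners of a triangle cut out by initial segments of a strong arrangement are
externally blocked. -/
theorem IsTri.not_blockedAt {X Y L : Set Pt} {y p q : Pt} (T : Δ.IsTri X Y L y p q)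
    (hΔ : Δ.Strong) : ¬ Δ.BlockedAt p y q := by
  intro hbl
  set P : Set (Pt × Pt × Pt) := {v | ∃ X Y L, Δ.IsTri X Y L v.1 v.2.1 v.2.2 ∧
    Δ.BlockedAt v.2.1 v.1 v.2.2} with hP
  have hfin : P.Finite := by
    refine (Δ.finite_vertices.prod (Δ.finite_vertices.prod Δ.finite_vertices)).subset ?_
    rintro ⟨y, p, q⟩ ⟨X, Y, L, T, -⟩
    exact ⟨⟨X, T.hX, Y, T.hY, T.XY, T.yX, T.yY⟩, ⟨X, T.hX, L, T.hL, T.XL, T.pX, T.pL⟩,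
      ⟨Y, T.hY, L, T.hL, T.YL, T.qY, T.qL⟩⟩
  obtain ⟨⟨y', p', q'⟩, ⟨X', Y', L', T', hb'⟩, hmin⟩ :=
    Set.exists_min_image P (fun v => area v.1 v.2.1 v.2.2) hfin ⟨(y, p, q), X, Y, L, T, hbl⟩
  have hmin' : ∀ X Y L y p q, Δ.IsTri X Y L y p q → Δ.BlockedAt p y q →
      area y' p' q' ≤ area y p q := fun X Y L y p q T h => hmin (y, p, q) ⟨X, Y, L, T, h⟩
  rcases T'.blocked_of_blocked hb' with h | h
  · refine MinTri.false (Δ := Δ) (X := L') (Y := Y') (L := X') (y := q') (p := p') (q := y')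
      ⟨T'.swap.rotate.swap, hb'.symm, h.symm, ?_⟩ hΔ
    intro X Y L y p q T h
    rw [area_swap, area_rotate, area_swap]
    exact hmin' X Y L y p q T h
  · exact MinTri.false ⟨T', hb', h, hmin'⟩ hΔ

theorem blockedAt_of_internallyBlocked {v v₁ v₂ : Pt}
    (h₁ : ∀ b ∈ Δ.B, v ∈ b → Δ.phi b v₁ ≠ 0) (h₂ : ∀ b ∈ Δ.B, v ∈ b → Δ.phi b v₂ ≠ 0)
    {R : Set Pt} (hR : R = convexHull ℝ {v, v₁, v₂}) (h : Δ.InternallyBlocked R v) :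
    Δ.BlockedAt v v₁ v₂ := by
  obtain ⟨b, hb, hvb, x, hxb, hx⟩ := h
  refine ⟨b, hb, hvb, ?_⟩
  by_contra! hle
  have hpos := hle.lt_of_ne' (mul_ne_zero (h₁ b hb hvb) (h₂ b hb hvb))
  have hsub : R ⊆ {z | 0 ≤ Δ.phi b v₁ * Δ.phi b z} := by
    rw [hR]
    refine convexHull_min ?_ ?_
    · rintro z (rfl | rfl | rfl)
      · simp [((mem_B_iff hb _).mp hvb).2]
      · exact mul_self_nonneg (Δ.phi b _)
      · exact hpos.le
    · rw [convex_iff_add_mem]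
      intro z hz w hw r s hr hs hrs
      have e : r • z + s • w = z + s • (w - z) := by
        rw [show r = 1 - s by linarith]; module
      simp only [mem_ofPred_eq] at hz hw ⊢
      rw [e, phi_lineMap, show 1 - s = r by linarith]
      nlinarith [mul_nonneg hr hz, mul_nonneg hs hw]
  have hopen : IsOpen ((fun t : ℝ => x + t • (v₁ - x)) ⁻¹' interior R) :=
    isOpen_interior.preimage (by fun_prop)
  obtain ⟨ε, hε, hball⟩ := Metric.isOpen_iff.mp hopen 0 (by simpa using hx)
  have hmem := hsub (interior_subset (hball (show -(ε / 2) ∈ Metric.ball (0 : ℝ) ε by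
    rw [Metric.mem_ball, Real.dist_eq, sub_zero, abs_neg, abs_of_pos (by positivity)]; linarith)))
  simp only [mem_ofPred_eq] at hmem
  rw [phi_lineMap, ((mem_B_iff hb x).mp hxb).2] at hmem
  nlinarith [mul_pos hε (mul_self_pos.mpr (h₁ b hb hvb))]

theorem IsTri.not_internallyBlocked {X Y L : Set Pt} {y p q : Pt} (T : Δ.IsTri X Y L y p q)
    (hΔ : Δ.Strong) : ¬ Δ.InternallyBlocked (convexHull ℝ {y, p, q}) y := fun h =>
  T.rotate.not_blockedAt hΔ <| blockedAt_of_internallyBlocked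
    (fun _ hb hyb h0 => T.ne_yp (block_inter hb T.hX hyb ((mem_B_iff hb p).mpr ⟨T.pT, h0⟩)
      T.yX T.pX))
    (fun _ hb hyb h0 => T.ne_yq (block_inter hb T.hY hyb ((mem_B_iff hb q).mpr ⟨T.qT, h0⟩)
      T.yY T.qY)) rfl h

/-- None of the corners of a triangle bounded by an edge and two proper initial segments of a
strong arrangement is internally blocked. -/
theorem not_internallyBlocked_of_edge (hΔ : Δ.Strong) {e A B : Set Pt}
    (he : e ∈ triEdges Δ.x1 Δ.x2 Δ.x3) (hA : A ∈ Δ.S) (hB : B ∈ Δ.S) {a b c : Pt} (hab : a ≠ b)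
    (hae : a ∈ e) (hbe : b ∈ e) (haA : a ∈ A) (hbB : b ∈ B) (hcA : c ∈ A) (hcB : c ∈ B)
    {R : Set Pt} (hR : R = convexHull ℝ {a, b, c}) : ¬ Δ.InternallyBlocked R a ∧
      ¬ Δ.InternallyBlocked R b ∧ ¬ Δ.InternallyBlocked R c := by
  have heS : e ∈ Δ.Sbar := Or.inr he
  have hAS : A ∈ Δ.Sbar := Or.inl hA
  have hne : ∀ {s}, s ∈ Δ.S → e ≠ s := fun hs h =>
    not_mem_edges_of_mem_S (Or.inl hs) (h ▸ he)
  have T : Δ.IsTri e A B a b c :=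
    ⟨heS, hAS, Or.inl hB, hne hA, hne hB,
      fun h => hab (Sbar_inter heS hAS (hne hA) hae hbe haA (h ▸ hbB)), hae, haA, hbe, hbB, hcA,
      hcB, Or.inr hA, Or.inr hB, Or.inl hA⟩
  subst hR
  refine ⟨T.not_internallyBlocked hΔ, ?_, ?_⟩
  · rw [insert_comm]
    exact T.rotate.not_internallyBlocked hΔ
  · rw [show ({a, b, c} : Set Pt) = {c, a, b} by ext; simp; tauto]
    exact T.swap.rotate.not_internallyBlocked hΔ

end TBA

/-- Lemma 13: under the hypotheses of Lemma 12, in the triangular regions `R₁ = a₁ b₁ c`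
and `R₂ = a₂ b₂ c` the vertices `a₁, b₁, c` resp. `a₂, b₂, c` are externally blocked. -/
theorem TBA.S12_external_blocks (Δ : TBA) (hstrong : Δ.Strong)
    (a₁ b₁ a₂ b₂ c : Pt)
    (hord₁ : Sbtw ℝ Δ.x1 b₁ a₁ ∧ Sbtw ℝ b₁ a₁ Δ.x2)
    (hord₂ : Sbtw ℝ Δ.x3 a₂ b₂ ∧ Sbtw ℝ a₂ b₂ Δ.x2)
    (ha₁ : a₁ ∈ segment ℝ Δ.x1 Δ.x2) (hb₁ : b₁ ∈ segment ℝ Δ.x1 Δ.x2)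
    (ha₂ : a₂ ∈ segment ℝ Δ.x2 Δ.x3) (hb₂ : b₂ ∈ segment ℝ Δ.x2 Δ.x3)
    (hA : segment ℝ a₁ a₂ ∈ Δ.S) (hB : segment ℝ b₁ b₂ ∈ Δ.S)
    (hc : c ∈ segment ℝ a₁ a₂ ∩ segment ℝ b₁ b₂)
    (R₁ R₂ : Set Pt)
    (hR₁reg : Δ.IsRegion R₁) (hR₁ : R₁ = convexHull ℝ {a₁, b₁, c})
    (hR₂reg : Δ.IsRegion R₂) (hR₂ : R₂ = convexHull ℝ {a₂, b₂, c}) :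
    ¬ Δ.InternallyBlocked R₁ a₁ ∧ ¬ Δ.InternallyBlocked R₁ b₁ ∧
    ¬ Δ.InternallyBlocked R₁ c ∧
    ¬ Δ.InternallyBlocked R₂ a₂ ∧ ¬ Δ.InternallyBlocked R₂ b₂ ∧
    ¬ Δ.InternallyBlocked R₂ c := by
  have h1 := TBA.not_internallyBlocked_of_edge hstrong (e := segment ℝ Δ.x1 Δ.x2)
    (by simp [triEdges]) hA hB hord₁.1.2.2.symm ha₁ hb₁ (left_mem_segment ℝ a₁ a₂)
    (left_mem_segment ℝ b₁ b₂) hc.1 hc.2 hR₁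
  have h2 := TBA.not_internallyBlocked_of_edge hstrong (e := segment ℝ Δ.x2 Δ.x3)
    (by simp [triEdges]) hA hB hord₂.1.2.2 ha₂ hb₂ (right_mem_segment ℝ a₁ a₂)
    (right_mem_segment ℝ b₁ b₂) hc.1 hc.2 hR₂
  exact ⟨h1.1, h1.2.1, h1.2.2, h2⟩
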